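/- Uniform asymptotics of the Kummer function along the upper imaginary direction (equation (4.4) in the proof of Theorem 4.1): Let a>0, σ>0, κ>0, j∈{0,1}, and let K be a compact subset of (0,∞). Then, as u→+∞, ₁F₁((1+iu)/κ + j, 2a/σ² + j, 2κv/σ²) ∼ (e^{κv/σ²}/(2√π)) · (2κv/σ²)^{1/4 − j/2 − a/σ²} · Γ(2a/σ² + j) · ((1+iu)/κ + j)^{1/4 − j/2 − a/σ²} · exp(2(1+i)·√(v·u/σ²)), uniformly for v∈K; that is, the ratio of the left-hand side to the right-hand side tends to 1 uniformly in v∈K as u→+∞. -/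

import Mathlib

open Filter

noncomputable section

/-- Kummer confluent hypergeometric function `₁F₁(x, b, y)`. -/
def hyp1F1 (x b y : ℂ) : ℂ :=
  ∑' n : ℕ, (Polynomial.eval x (ascPochhammer ℂ n)
      / (Polynomial.eval b (ascPochhammer ℂ n) * (n.factorial : ℂ))) * y ^ n

open Topology MeasureTheory

/-- Power series with coefficients `c`. -/
def ps (c : ℕ → ℂ) (y : ℂ) : ℂ := ∑' n : ℕ, c n * y ^ n

/-- Coefficient sequences of entire functions. -/
def Ent (c : ℕ → ℂ) : Prop := ∀ R : ℝ, 0 ≤ R → Summable (fun n => ‖c n‖ * R ^ n)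

/-- Coefficients of the derivative. -/
def dco (c : ℕ → ℂ) (n : ℕ) : ℂ := ((n : ℂ) + 1) * c (n + 1)

lemma Ent.summable {c : ℕ → ℂ} (h : Ent c) (y : ℂ) : Summable (fun n => c n * y ^ n) := by
  apply Summable.of_norm
  simpa [norm_mul, norm_pow] using h ‖y‖ (norm_nonneg y)

lemma Ent.dco {c : ℕ → ℂ} (h : Ent c) : Ent (dco c) := by
  intro R hR
  have h2 := h (2 * (R + 1)) (by positivity)
  rw [← summable_nat_add_iff 1] at h2
  refine Summable.of_nonneg_of_le (fun n => by positivity) (fun n => ?_) h2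
  have h3 : ((n : ℝ) + 1) ≤ 2 ^ (n + 1) := by
    have := (Nat.lt_two_pow_self (n := n + 1)).le
    exact_mod_cast this
  have h4 : ‖_root_.dco c n‖ = ((n : ℝ) + 1) * ‖c (n + 1)‖ := by
    unfold _root_.dco
    rw [norm_mul]
    congr 1
    have : ((n : ℂ) + 1) = ((n + 1 : ℕ) : ℂ) := by push_cast; ring
    rw [this, Complex.norm_natCast]
    push_cast; ring
  rw [h4, mul_pow]
  have h5 : R ^ n ≤ (R + 1) ^ (n + 1) := by
    calc R ^ n ≤ (R + 1) ^ n := by gcongr; linarith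
      _ ≤ (R + 1) ^ (n + 1) := by
        apply pow_le_pow_right₀ <;> [linarith; omega]
  calc ((n : ℝ) + 1) * ‖c (n + 1)‖ * R ^ n
      = ‖c (n + 1)‖ * (((n : ℝ) + 1) * R ^ n) := by ring
    _ ≤ _ := by gcongr

lemma Ent.hasDerivAt {c : ℕ → ℂ} (h : Ent c) (y : ℂ) :
    HasDerivAt (ps c) (ps (_root_.dco c) y) y := by
  set R : ℝ := ‖y‖ + 1
  have hR : 0 ≤ R := by positivity
  have key := hasDerivAt_tsum_of_isPreconnected (𝕜 := ℂ)
    (u := fun n => ‖_root_.dco c (n - 1)‖ * R ^ (n - 1))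
    (g := fun n y => c n * y ^ n) (g' := fun n y => c n * ((n : ℂ) * y ^ (n - 1)))
    (t := Metric.ball 0 R) (y₀ := 0) (y := y) ?_ Metric.isOpen_ball
    (convex_ball _ _).isPreconnected ?_ ?_ ?_ ?_ ?_
  · convert! key using 1
    have hs : Summable (fun n => c n * ((n : ℂ) * y ^ (n - 1))) := by
      rw [← summable_nat_add_iff 1]
      convert! h.dco.summable y using 2 with n
      unfold _root_.dco
      push_cast
      ring
    rw [hs.tsum_eq_zero_add]
    simp only [ps, CharP.cast_eq_zero, zero_mul, mul_zero, zero_add]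
    congr 1
    ext n
    unfold _root_.dco
    push_cast
    ring
  · rw [← summable_nat_add_iff 1]
    simpa using h.dco R hR
  · intro n z _
    exact (hasDerivAt_pow n z).const_mul (c n)
  · intro n z hz
    rcases n with _ | n
    · simp
    · have : ‖z‖ ≤ R := by simpa using (mem_ball_zero_iff.mp hz).le
      simp only [Nat.add_sub_cancel]
      rw [show c (n + 1) * (((n + 1 : ℕ) : ℂ) * z ^ n) = _root_.dco c n * z ^ n by
        unfold _root_.dco; push_cast; ring]
      rw [norm_mul, norm_pow]
      gcongr
  · simp [R]; positivity
  · exact h.summable 0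
  · simp [R]

lemma ent_of_rec {c : ℕ → ℂ} {b : ℝ} (hb : 0 < b) {p q : ℂ}
    (h : ∀ n : ℕ, ((n : ℂ) + 1) * (b + n) * c (n + 1) = (p + q * n) * c n) : Ent c := by
  intro R hR
  apply summable_of_ratio_norm_eventually_le (r := 1 / 2) (by norm_num)
  filter_upwards [eventually_ge_atTop (⌈2 * R * (‖p‖ + ‖q‖)⌉₊ + 1)] with n hn
  have hn1 : 2 * R * (‖p‖ + ‖q‖) ≤ n := by
    have := Nat.le_ceil (2 * R * (‖p‖ + ‖q‖))
    have h2 : ((⌈2 * R * (‖p‖ + ‖q‖)⌉₊ : ℝ) + 1) ≤ n := by exact_mod_cast hn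
    linarith
  have hn0 : (1 : ℝ) ≤ n := by
    have : 1 ≤ n := by omega
    exact_mod_cast this
  have h1 := congrArg norm (h n)
  rw [norm_mul, norm_mul, norm_mul] at h1
  have e1 : ‖(n : ℂ) + 1‖ = (n : ℝ) + 1 := by
    rw [show ((n : ℂ) + 1) = (((n : ℝ) + 1 : ℝ) : ℂ) by push_cast; ring, Complex.norm_real,
      Real.norm_of_nonneg (by positivity)]
  have e2 : ‖(b : ℂ) + n‖ = b + n := by
    rw [show ((b : ℂ) + n) = ((b + n : ℝ) : ℂ) by push_cast; ring, Complex.norm_real,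
      Real.norm_of_nonneg (by positivity)]
  have e3 : ‖p + q * n‖ ≤ (‖p‖ + ‖q‖) * (n + 1) := by
    calc ‖p + q * n‖ ≤ ‖p‖ + ‖q * n‖ := norm_add_le _ _
      _ = ‖p‖ + ‖q‖ * n := by simp
      _ ≤ _ := by nlinarith [norm_nonneg p, norm_nonneg q]
  rw [e1, e2] at h1
  have h3 : (n : ℝ) * ‖c (n + 1)‖ ≤ (‖p‖ + ‖q‖) * ‖c n‖ := by
    have : ((n : ℝ) + 1) * (n * ‖c (n + 1)‖) ≤ (n + 1) * ((‖p‖ + ‖q‖) * ‖c n‖) := by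
      calc ((n : ℝ) + 1) * (n * ‖c (n + 1)‖) ≤ (n + 1) * (b + n) * ‖c (n + 1)‖ := by
            rw [mul_assoc]; gcongr; linarith
        _ = ‖p + q * n‖ * ‖c n‖ := h1
        _ ≤ (‖p‖ + ‖q‖) * (n + 1) * ‖c n‖ := by gcongr
        _ = _ := by ring
    exact le_of_mul_le_mul_left this (by positivity)
  simp only [norm_mul, norm_norm, norm_pow, Real.norm_of_nonneg hR]
  have h4 : R * ‖c (n + 1)‖ ≤ 1 / 2 * ‖c n‖ := by
    have hc := norm_nonneg (c n)
    have : (n : ℝ) * (R * ‖c (n + 1)‖) ≤ n * (1 / 2 * ‖c n‖) := by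
      calc (n : ℝ) * (R * ‖c (n + 1)‖) = R * (n * ‖c (n + 1)‖) := by ring
        _ ≤ R * ((‖p‖ + ‖q‖) * ‖c n‖) := by gcongr
        _ = 1 / 2 * ‖c n‖ * (2 * R * (‖p‖ + ‖q‖)) := by ring
        _ ≤ 1 / 2 * ‖c n‖ * n := by gcongr
        _ = _ := by ring
    exact le_of_mul_le_mul_left this (by linarith)
  calc ‖c (n + 1)‖ * R ^ (n + 1) = R ^ n * (R * ‖c (n + 1)‖) := by ring
    _ ≤ R ^ n * (1 / 2 * ‖c n‖) := by gcongr
    _ = _ := by ring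

lemma ps_ode {c : ℕ → ℂ} {b : ℝ} (hb : 0 < b) {p q : ℂ}
    (h : ∀ n : ℕ, ((n : ℂ) + 1) * (b + n) * c (n + 1) = (p + q * n) * c n) (y : ℂ) :
    y * ps (dco (dco c)) y + b * ps (dco c) y = q * (y * ps (dco c) y) + p * ps c y := by
  have hc := ent_of_rec hb h
  have shift : ∀ d : ℕ → ℂ, Ent d → 
      HasSum (fun n : ℕ => (n : ℂ) * d n * y ^ n) (y * ps (dco d) y) := by
    intro d hd
    have h1 := ((hd.dco.summable y).hasSum).mul_left y
    rw [← hasSum_nat_add_iff' 1]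
    simp only [Finset.range_one, Finset.sum_singleton, CharP.cast_eq_zero, zero_mul, sub_zero]
    convert! h1 using 2 with n
    unfold dco
    push_cast
    ring
  have s1 := (shift _ hc.dco).add ((hc.dco.summable y).hasSum.mul_left (b : ℂ))
  have s2 := ((shift _ hc).mul_left q).add ((hc.summable y).hasSum.mul_left p)
  refine s1.unique ?_
  convert! s2 using 2 with n
  have := h n
  unfold dco
  linear_combination (y ^ n) * this

/-- coefficients of the Kummer function -/
def coF (x b : ℂ) (n : ℕ) : ℂ := Polynomial.eval x (ascPochhammer ℂ n)
      / (Polynomial.eval b (ascPochhammer ℂ n) * (n.factorial : ℂ))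

/-- coefficients of `₀F₁` -/
def coG (b : ℂ) (n : ℕ) : ℂ := 1 / (Polynomial.eval b (ascPochhammer ℂ n) * (n.factorial : ℂ))

lemma asc_ne {b : ℝ} (hb : 0 < b) (n : ℕ) : Polynomial.eval (b : ℂ) (ascPochhammer ℂ n) ≠ 0 := by
  induction n with
  | zero => simp
  | succ n ih =>
    rw [ascPochhammer_succ_eval]
    refine mul_ne_zero ih ?_
    have : (b + n : ℝ) ≠ 0 := by positivity
    exact_mod_cast this

lemma bn_ne {b : ℝ} (hb : 0 < b) (n : ℕ) : (b : ℂ) + n ≠ 0 := by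
  have : (b + n : ℝ) ≠ 0 := by positivity
  exact_mod_cast this

lemma coF_rec {b : ℝ} (hb : 0 < b) (x : ℂ) (n : ℕ) :
    ((n : ℂ) + 1) * (b + n) * coF x b (n + 1) = (x + 1 * n) * coF x b n := by
  unfold coF
  rw [ascPochhammer_succ_eval, ascPochhammer_succ_eval, Nat.factorial_succ]
  have h1 := asc_ne hb n
  have h2 := bn_ne hb n
  have h3 : (n.factorial : ℂ) ≠ 0 := by exact_mod_cast n.factorial_ne_zero
  have h4 : ((n : ℂ) + 1) ≠ 0 := by exact_mod_cast n.succ_ne_zero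
  push_cast
  field_simp

lemma coG_rec {b : ℝ} (hb : 0 < b) (n : ℕ) :
    ((n : ℂ) + 1) * (b + n) * coG b (n + 1) = (1 + 0 * n) * coG b n := by
  unfold coG
  rw [ascPochhammer_succ_eval, Nat.factorial_succ]
  have h1 := asc_ne hb n
  have h2 := bn_ne hb n
  have h3 : (n.factorial : ℂ) ≠ 0 := by exact_mod_cast n.factorial_ne_zero
  have h4 : ((n : ℂ) + 1) ≠ 0 := by exact_mod_cast n.succ_ne_zero
  push_cast
  field_simp
  simp

lemma asc_shift (b : ℂ) (n : ℕ) : Polynomial.eval b (ascPochhammer ℂ (n + 1))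
    = b * Polynomial.eval (b + 1) (ascPochhammer ℂ n) := by
  rw [ascPochhammer_succ_left]
  simp [Polynomial.eval_comp]

lemma ent_coG {b : ℝ} (hb : 0 < b) : Ent (coG b) := ent_of_rec hb (coG_rec hb)

/-- derivative of `₀F₁` -/
lemma dco_coG {b : ℝ} (hb : 0 < b) (z : ℂ) :
    ps (dco (coG b)) z = 1 / b * ps (coG ((b + 1 : ℝ) : ℂ)) z := by
  unfold ps
  rw [← tsum_mul_left]
  congr 1
  ext n
  have h1 := asc_ne (show 0 < b + 1 by linarith) n
  have h3 : (n.factorial : ℂ) ≠ 0 := by exact_mod_cast n.factorial_ne_zero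
  have h4 : ((n : ℂ) + 1) ≠ 0 := by exact_mod_cast n.succ_ne_zero
  have h5 : (b : ℂ) ≠ 0 := by exact_mod_cast hb.ne'
  unfold dco coG
  push_cast at h1 ⊢
  rw [asc_shift, Nat.factorial_succ]
  push_cast
  field_simp

/-- contiguity relation -/
lemma G_contig {b : ℝ} (hb : 0 < b) (z : ℂ) :
    ps (coG b) z = ps (coG ((b + 1 : ℝ) : ℂ)) z
      + z / (b * (b + 1)) * ps (coG ((b + 2 : ℝ) : ℂ)) z := by
  have h5 : (b : ℂ) ≠ 0 := by exact_mod_cast hb.ne'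
  have h6 : (b : ℂ) + 1 ≠ 0 := by exact_mod_cast (show (b + 1 : ℝ) ≠ 0 by positivity)
  have hb1 : 0 < b + 1 := by linarith
  have h := ps_ode hb (coG_rec hb) z
  have h1 : HasDerivAt (ps (dco (coG b))) (ps (dco (dco (coG b))) z) z := (ent_coG hb).dco.hasDerivAt z
  have h2 : HasDerivAt (ps (dco (coG b))) (1 / b * (1 / ((b + 1 : ℝ) : ℂ) *
      ps (coG ((b + 1 + 1 : ℝ) : ℂ)) z)) z := by
    have := ((ent_coG hb1).hasDerivAt z).const_mul (1 / (b : ℂ))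
    rw [dco_coG hb1] at this
    exact this.congr_of_eventuallyEq (Eventually.of_forall fun w => dco_coG hb w)
  have h3 := h1.unique h2
  rw [h3, dco_coG hb] at h
  rw [show b + 2 = b + 1 + 1 by ring]
  push_cast at h ⊢
  field_simp at h ⊢
  linear_combination -h


lemma hre {f : ℝ → ℂ} {f' : ℂ} {x : ℝ} (h : HasDerivAt f f' x) :
    HasDerivAt (fun x => (f x).re) f'.re x :=
  (Complex.reCLM.hasFDerivAt.comp_hasDerivAt x h)

lemma him {f : ℝ → ℂ} {f' : ℂ} {x : ℝ} (h : HasDerivAt f f' x) :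
    HasDerivAt (fun x => (f x).im) f'.im x :=
  (Complex.imCLM.hasFDerivAt.comp_hasDerivAt x h)

/-- Mean value inequality with derivatives in the open interval only. -/
lemma mvt_bound {F F' : ℝ → ℂ} {B B' : ℝ → ℝ} {s t : ℝ} (hst : s ≤ t)
    (hF : ContinuousOn F (Set.Icc s t)) (hB : ContinuousOn B (Set.Icc s t))
    (hF' : ∀ x ∈ Set.Ioo s t, HasDerivAt F (F' x) x)
    (hB' : ∀ x ∈ Set.Ioo s t, HasDerivAt B (B' x) x)
    (hle : ∀ x ∈ Set.Ioo s t, ‖F' x‖ ≤ B' x) : ‖F t - F s‖ ≤ B t - B s := by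
  set z := F t - F s with hz
  have hBm : B s ≤ B t := by
    have : MonotoneOn B (Set.Icc s t) := by
      apply monotoneOn_of_deriv_nonneg (convex_Icc s t) hB
      · rw [interior_Icc]
        intro x hx
        exact (hB' x hx).differentiableAt.differentiableWithinAt
      · rw [interior_Icc]
        intro x hx
        rw [(hB' x hx).deriv]
        exact (norm_nonneg _).trans (hle x hx)
    exact this (Set.left_mem_Icc.2 hst) (Set.right_mem_Icc.2 hst) hst
  rcases eq_or_lt_of_le (norm_nonneg z) with h0 | h0
  · rw [← h0]; linarith
  have hd : ∀ x ∈ Set.Ioo s t, HasDerivAt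
      (fun x => B x * ‖z‖ - ((starRingEnd ℂ z) * F x).re)
      (B' x * ‖z‖ - ((starRingEnd ℂ z) * F' x).re) x := by
    intro x hx
    exact ((hB' x hx).mul_const _).sub (hre ((hF' x hx).const_mul _))
  have hm : MonotoneOn (fun x => B x * ‖z‖ - ((starRingEnd ℂ z) * F x).re) (Set.Icc s t) := by
    apply monotoneOn_of_deriv_nonneg (convex_Icc s t)
    · apply ContinuousOn.sub (hB.mul continuousOn_const)
      exact Complex.continuous_re.comp_continuousOn (continuousOn_const.mul hF)
    · rw [interior_Icc]
      intro x hx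
      exact (hd x hx).differentiableAt.differentiableWithinAt
    · rw [interior_Icc]
      intro x hx
      rw [(hd x hx).deriv]
      have h1 : ((starRingEnd ℂ z) * F' x).re ≤ ‖z‖ * ‖F' x‖ := by
        refine (Complex.re_le_norm _).trans ?_
        rw [norm_mul, RCLike.norm_conj]
      have h2 := hle x hx
      nlinarith
  have h1 := hm (Set.left_mem_Icc.2 hst) (Set.right_mem_Icc.2 hst) hst
  have h2 : ((starRingEnd ℂ z) * F t).re - ((starRingEnd ℂ z) * F s).re = ‖z‖ * ‖z‖ := by
    rw [← Complex.sub_re, ← mul_sub, ← hz, mul_comm, Complex.mul_conj, Complex.ofReal_re,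
      Complex.normSq_eq_norm_sq, sq]
  simp only at h1
  have h3 : ‖z‖ * ‖z‖ ≤ (B t - B s) * ‖z‖ := by linarith
  exact le_of_mul_le_mul_right h3 h0

/-- The imaginary Wronskian-type quantity. -/
def imW (g g1 : ℝ → ℂ) (t : ℝ) : ℝ := (g1 t).im * (g t).re - (g1 t).re * (g t).im

lemma imW_le (g g1 : ℝ → ℂ) (t : ℝ) : imW g g1 t ≤ ‖g1 t‖ * ‖g t‖ := by
  have : imW g g1 t = (g1 t * starRingEnd ℂ (g t)).im := by
    simp [imW]; ring
  rw [this]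
  refine (Complex.im_le_norm _).trans ?_
  rw [norm_mul, RCLike.norm_conj]

section compare
variable {b μ : ℝ} {g g1 g2 : ℝ → ℂ}

lemma imW_deriv (hg : ∀ y, HasDerivAt g (g1 y) y) (hg1 : ∀ y, HasDerivAt g1 (g2 y) y)
    (og : ∀ y : ℝ, 0 < y → (y : ℂ) * g2 y + b * g1 y = Complex.I * μ * g y)
    {t : ℝ} (ht : 0 < t) :
    HasDerivAt (fun t => t ^ b * imW g g1 t) (μ * t ^ (b - 1) * ‖g t‖ ^ 2) t := by
  have h1 := Real.hasDerivAt_rpow_const (p := b) (Or.inl ht.ne')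
  have h2 := ((him (hg1 t)).mul (hre (hg t))).sub ((hre (hg1 t)).mul (him (hg t)))
  have h3 := h1.mul h2
  convert! h3 using 1
  have ht' : t ^ b = t ^ (b - 1) * t := by
    rw [Real.rpow_sub_one ht.ne']; field_simp
  have o := og t ht
  have ore := congrArg Complex.re o
  have oim := congrArg Complex.im o
  simp at ore oim
  rw [ht', Complex.sq_norm, Complex.normSq_apply]
  simp only [Pi.sub_apply, Pi.mul_apply]
  linear_combination t ^ (b - 1) * ((g t).im * ore - (g t).re * oim)

lemma imW_pos (hb : 0 < b) (hμ : 0 < μ)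
    (hg : ∀ y, HasDerivAt g (g1 y) y) (hg1 : ∀ y, HasDerivAt g1 (g2 y) y)
    (og : ∀ y : ℝ, 0 < y → (y : ℂ) * g2 y + b * g1 y = Complex.I * μ * g y)
    (g0 : g 0 = 1) {t : ℝ} (ht : 0 < t) : 0 < imW g g1 t := by
  have hgc : Continuous g := continuous_iff_continuousAt.2 fun y => (hg y).continuousAt
  have hg1c : Continuous g1 := continuous_iff_continuousAt.2 fun y => (hg1 y).continuousAt
  have hWc : Continuous (imW g g1) := by unfold imW; fun_prop
  have hbc : Continuous (fun t : ℝ => t ^ b) := Real.continuous_rpow_const hb.le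
  have hm : MonotoneOn (fun t => t ^ b * imW g g1 t) (Set.Ici 0) := by
    apply monotoneOn_of_deriv_nonneg (convex_Ici 0)
    · exact (hbc.mul hWc).continuousOn
    · rw [interior_Ici]
      intro x hx
      exact (imW_deriv hg hg1 og hx).differentiableAt.differentiableWithinAt
    · rw [interior_Ici]
      intro x hx
      rw [(imW_deriv hg hg1 og hx).deriv]
      have : (0 : ℝ) < x := hx
      positivity
  have h00 : (0 : ℝ) ^ b * imW g g1 0 = 0 := by rw [Real.zero_rpow hb.ne', zero_mul]
  have hnn : ∀ s, 0 ≤ s → 0 ≤ s ^ b * imW g g1 s := by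
    intro s hs
    have := hm (Set.mem_Ici.2 le_rfl) (Set.mem_Ici.2 hs) hs
    simpa [h00] using this
  have htb : 0 < t ^ b := Real.rpow_pos_of_pos ht b
  by_contra hcon
  have hz : t ^ b * imW g g1 t = 0 := le_antisymm
    (mul_nonpos_of_nonneg_of_nonpos htb.le (not_lt.1 hcon)) (hnn t ht.le)
  -- near zero the norm of g is positive
  have hne : ∀ᶠ s in 𝓝 (0 : ℝ), g s ≠ 0 := by
    apply hgc.continuousAt.eventually_ne
    rw [g0]; exact one_ne_zero
  have h3 : ∀ᶠ s in 𝓝[>] (0 : ℝ), g s ≠ 0 ∧ s ∈ Set.Ioo 0 t :=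
    (hne.filter_mono nhdsWithin_le_nhds).and (Ioo_mem_nhdsGT ht)
  obtain ⟨s, hs1, hs2⟩ := h3.exists
  have hloc : (fun x => x ^ b * imW g g1 x) =ᶠ[𝓝 s] fun _ => 0 := by
    filter_upwards [Ioo_mem_nhds hs2.1 hs2.2] with x hx
    apply le_antisymm _ (hnn x hx.1.le)
    have := hm (Set.mem_Ici.2 hx.1.le) (Set.mem_Ici.2 ht.le) hx.2.le
    simp only [hz] at this
    exact this
  have hd0 : HasDerivAt (fun x => x ^ b * imW g g1 x) 0 s :=
    (hasDerivAt_const s (0 : ℝ)).congr_of_eventuallyEq hloc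
  have := hd0.unique (imW_deriv hg hg1 og hs2.1)
  have h5 : 0 < μ * s ^ (b - 1) * ‖g s‖ ^ 2 := by
    have := Real.rpow_pos_of_pos hs2.1 (b - 1)
    have := norm_pos_iff.2 hs1
    positivity
  linarith

lemma g_ne_zero (hb : 0 < b) (hμ : 0 < μ)
    (hg : ∀ y, HasDerivAt g (g1 y) y) (hg1 : ∀ y, HasDerivAt g1 (g2 y) y)
    (og : ∀ y : ℝ, 0 < y → (y : ℂ) * g2 y + b * g1 y = Complex.I * μ * g y)
    (g0 : g 0 = 1) {t : ℝ} (ht : 0 ≤ t) : g t ≠ 0 := by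
  rcases eq_or_lt_of_le ht with h | h
  · rw [← h, g0]; exact one_ne_zero
  · intro h0
    have := imW_pos hb hμ hg hg1 og g0 h
    simp [imW, h0] at this

lemma compare {f f1 f2 q : ℝ → ℂ} {Y C A η δ : ℝ} (hb : 0 < b) (hμ : 0 < μ)
    (hg : ∀ y, HasDerivAt g (g1 y) y) (hg1 : ∀ y, HasDerivAt g1 (g2 y) y)
    (og : ∀ y : ℝ, 0 < y → (y : ℂ) * g2 y + b * g1 y = Complex.I * μ * g y)
    (g0 : g 0 = 1)
    (hf : ∀ y, HasDerivAt f (f1 y) y) (hf1 : ∀ y, HasDerivAt f1 (f2 y) y)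
    (of : ∀ y : ℝ, 0 < y → (y : ℂ) * f2 y + b * f1 y = (Complex.I * μ + q y) * f y)
    (f0 : f 0 = 1) (hC : 0 ≤ C) (hA : 0 ≤ A) (hη : 0 ≤ η)
    (hq : ∀ y ∈ Set.Icc 0 Y, ‖q y‖ ≤ C)
    (hδ : 0 < δ) (hδY : δ < Y)
    (b1 : ∀ t ∈ Set.Icc 0 Y, ‖g1 t‖ ≤ μ * A * ‖g t‖)
    (b2 : ∀ t ∈ Set.Icc δ Y, ‖g1 t‖ ≤ μ * η * ‖g t‖)
    (hε : C * (A * δ + η * Y) ≤ 1 / 2) {y : ℝ} (hy : y ∈ Set.Icc 0 Y) :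
    ‖f y / g y - 1‖ ≤ 2 * (C * (A * δ + η * Y)) := by
  have hgc : Continuous g := continuous_iff_continuousAt.2 fun y => (hg y).continuousAt
  have hg1c : Continuous g1 := continuous_iff_continuousAt.2 fun y => (hg1 y).continuousAt
  have hfc : Continuous f := continuous_iff_continuousAt.2 fun y => (hf y).continuousAt
  have hf1c : Continuous f1 := continuous_iff_continuousAt.2 fun y => (hf1 y).continuousAt
  have hWc : Continuous (imW g g1) := by unfold imW; fun_prop
  have hbc : Continuous (fun t : ℝ => t ^ b) := Real.continuous_rpow_const hb.le
  have gne : ∀ t, 0 ≤ t → g t ≠ 0 := fun t ht => g_ne_zero hb hμ hg hg1 og g0 ht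
  set h : ℝ → ℂ := fun t => f t / g t with hh
  have hhc : ContinuousOn h (Set.Icc 0 Y) :=
    hfc.continuousOn.div hgc.continuousOn fun t ht => gne t ht.1
  have hY : 0 < Y := hδ.trans hδY
  obtain ⟨ys, hys, hmax⟩ := isCompact_Icc.exists_isMaxOn (Set.nonempty_Icc.2 hY.le) hhc.norm
  set H := ‖h ys‖ with hH
  have hHle : ∀ t ∈ Set.Icc 0 Y, ‖f t‖ ≤ H * ‖g t‖ := by
    intro t ht
    have h1 : ‖h t‖ ≤ H := hmax ht
    have h2 : f t = h t * g t := by rw [hh]; field_simp [gne t ht.1]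
    rw [h2, norm_mul]
    gcongr
  have hH0 : 0 ≤ H := norm_nonneg _
  -- the Wronskian
  set W : ℝ → ℂ := fun t => ((t ^ b : ℝ) : ℂ) * (f1 t * g t - f t * g1 t) with hW
  have hWb : ∀ t ∈ Set.Icc 0 Y, ‖W t‖ ≤ C * H / μ * (t ^ b * imW g g1 t) := by
    intro t ht
    have key := mvt_bound (F := W) (B := fun t => C * H / μ * (t ^ b * imW g g1 t))
      (F' := fun t => ((t ^ (b - 1) : ℝ) : ℂ) * (q t * f t * g t))
      (B' := fun t => C * H / μ * (μ * t ^ (b - 1) * ‖g t‖ ^ 2)) ht.1 ?_ ?_ ?_ ?_ ?_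
    · simpa [hW, Real.zero_rpow hb.ne'] using key
    · rw [hW]
      apply Continuous.continuousOn
      have := Complex.continuous_ofReal.comp hbc
      simp only [Function.comp_def] at this
      fun_prop
    · exact (continuous_const.mul (hbc.mul hWc)).continuousOn
    · intro x hx
      have h1 := (Real.hasDerivAt_rpow_const (x := x) (p := b) (Or.inl hx.1.ne')).ofReal_comp
      have h2 := h1.mul (((hf1 x).mul (hg x)).sub ((hf x).mul (hg1 x)))
      convert! h2 using 1
      have ht' : x ^ b = x ^ (b - 1) * x := by
        rw [Real.rpow_sub_one hx.1.ne']; field_simp [hx.1.ne']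
      have o1 := of x hx.1
      have o2 := og x hx.1
      rw [ht']
      simp only [Pi.sub_apply, Pi.mul_apply]
      push_cast
      linear_combination ((x ^ (b - 1) : ℝ) : ℂ) * (f x * o2 - g x * o1)
    · intro x hx
      exact (imW_deriv hg hg1 og hx.1).const_mul _
    · intro x hx
      have hxY : x ∈ Set.Icc 0 Y := ⟨hx.1.le, hx.2.le.trans ht.2⟩
      have hp : 0 < x ^ (b - 1) := Real.rpow_pos_of_pos hx.1 _
      rw [norm_mul, norm_mul, norm_mul, Complex.norm_real, Real.norm_of_nonneg hp.le]
      calc x ^ (b - 1) * (‖q x‖ * ‖f x‖ * ‖g x‖)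
          ≤ x ^ (b - 1) * (C * (H * ‖g x‖) * ‖g x‖) := by
            gcongr
            · exact hq x hxY
            · exact hHle x hxY
        _ = _ := by field_simp
  have hd : ∀ t ∈ Set.Ioo 0 Y, HasDerivAt h ((f1 t * g t - f t * g1 t) / g t ^ 2) t := by
    intro t ht
    exact (hf t).div (hg t) (gne t ht.1.le)
  have hdb : ∀ t ∈ Set.Ioo 0 Y, ∀ E, ‖g1 t‖ ≤ μ * E * ‖g t‖ →
      ‖(f1 t * g t - f t * g1 t) / g t ^ 2‖ ≤ C * H * E := by
    intro t ht E hE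
    have hp : 0 < t ^ b := Real.rpow_pos_of_pos ht.1 _
    have h1 := hWb t ⟨ht.1.le, ht.2.le⟩
    rw [hW] at h1
    simp only at h1
    rw [norm_mul, Complex.norm_real, Real.norm_of_nonneg hp.le] at h1
    have hgp : 0 < ‖g t‖ := norm_pos_iff.2 (gne t ht.1.le)
    have h2 : ‖f1 t * g t - f t * g1 t‖ ≤ C * H / μ * imW g g1 t := by
      refine le_of_mul_le_mul_left ?_ hp
      linarith
    rw [norm_div, norm_pow, div_le_iff₀ (by positivity)]
    calc _ ≤ C * H / μ * imW g g1 t := h2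
      _ ≤ C * H / μ * (μ * E * ‖g t‖ * ‖g t‖) := by
          gcongr
          exact (imW_le g g1 t).trans (by gcongr)
      _ = _ := by field_simp
  have s1 : ∀ t ∈ Set.Icc 0 δ, ‖h t - 1‖ ≤ C * H * A * t := by
    intro t ht
    have key := mvt_bound (F := h) (B := fun t => C * H * A * t)
      (F' := fun t => (f1 t * g t - f t * g1 t) / g t ^ 2) (B' := fun _ => C * H * A) ht.1
      (hhc.mono (Set.Icc_subset_Icc le_rfl (ht.2.trans hδY.le)))
      (by fun_prop)
      (fun x hx => hd x ⟨hx.1, hx.2.trans_le (ht.2.trans hδY.le)⟩)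
      (fun x _ => by simpa using (hasDerivAt_id x).const_mul (C * H * A))
      (fun x hx => hdb x ⟨hx.1, hx.2.trans_le (ht.2.trans hδY.le)⟩ A
        (b1 x ⟨hx.1.le, hx.2.le.trans (ht.2.trans hδY.le)⟩))
    simpa [hh, f0, g0] using key
  have s2 : ∀ t ∈ Set.Icc δ Y, ‖h t - h δ‖ ≤ C * H * η * (t - δ) := by
    intro t ht
    have key := mvt_bound (F := h) (B := fun t => C * H * η * t)
      (F' := fun t => (f1 t * g t - f t * g1 t) / g t ^ 2) (B' := fun _ => C * H * η) ht.1
      (hhc.mono (Set.Icc_subset_Icc hδ.le ht.2))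
      (by fun_prop)
      (fun x hx => hd x ⟨hδ.trans hx.1, hx.2.trans_le ht.2⟩)
      (fun x _ => by simpa using (hasDerivAt_id x).const_mul (C * H * η))
      (fun x hx => hdb x ⟨hδ.trans hx.1, hx.2.trans_le ht.2⟩ η
        (b2 x ⟨hx.1.le, hx.2.le.trans ht.2⟩))
    linarith
  have s3 : ∀ t ∈ Set.Icc 0 Y, ‖h t - 1‖ ≤ H * (C * (A * δ + η * Y)) := by
    intro t ht
    have hA' : 0 ≤ C * H * A := by positivity
    have hη' : 0 ≤ C * H * η := by positivity
    rcases le_total t δ with h1 | h1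
    · have := s1 t ⟨ht.1, h1⟩
      nlinarith
    · have k1 := s1 δ ⟨hδ.le, le_rfl⟩
      have k2 := s2 t ⟨h1, ht.2⟩
      have k3 : ‖h t - 1‖ ≤ ‖h t - h δ‖ + ‖h δ - 1‖ := by
        have := norm_add_le (h t - h δ) (h δ - 1)
        simpa using this
      nlinarith [ht.2]
  have hε0 : 0 ≤ C * (A * δ + η * Y) := by positivity
  have hH2 : H ≤ 2 := by
    have k1 := s3 ys hys
    have k2 : H ≤ ‖h ys - 1‖ + 1 := by
      have := norm_add_le (h ys - 1) 1
      simpa [hH] using this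
    nlinarith
  refine (s3 y hy).trans ?_
  gcongr
end compare


lemma integrable_rpow_exp {s c : ℝ} (hs : 0 < s) (hc : 0 < c) :
    IntegrableOn (fun q : ℝ => q ^ (s - 1) * Real.exp (-c * q)) (Set.Ioi 0) := by
  have := integrableOn_rpow_mul_exp_neg_mul_rpow (s := s - 1) (p := 1) (b := c)
    (by linarith) one_pos hc
  simpa using this

lemma laplace_meas (s : ℝ) (z : ℂ) : AEStronglyMeasurable
    (fun q : ℝ => ((q ^ (s - 1) : ℝ) : ℂ) * Complex.exp (-z * q)) (volume.restrict (Set.Ioi 0)) := by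
  apply Measurable.aestronglyMeasurable
  have : Measurable (fun q : ℝ => q ^ (s - 1)) := by fun_prop
  have h2 := Complex.measurable_ofReal.comp this
  simp only [Function.comp_def] at h2
  exact h2.mul (by fun_prop)

lemma laplace_norm (s : ℝ) (z : ℂ) {q : ℝ} (hq : 0 < q) :
    ‖((q ^ (s - 1) : ℝ) : ℂ) * Complex.exp (-z * q)‖ = q ^ (s - 1) * Real.exp (-z.re * q) := by
  rw [norm_mul, Complex.norm_real, Real.norm_of_nonneg (by positivity), Complex.norm_exp]
  simp

lemma laplace_integrable {s : ℝ} (hs : 0 < s) {z : ℂ} (hz : 0 < z.re) : IntegrableOn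
    (fun q : ℝ => ((q ^ (s - 1) : ℝ) : ℂ) * Complex.exp (-z * q)) (Set.Ioi 0) := by
  refine Integrable.mono' (integrable_rpow_exp hs hz) (laplace_meas s z) ?_
  filter_upwards [ae_restrict_mem measurableSet_Ioi] with q hq
  rw [laplace_norm s z hq]

lemma laplace_gamma {s : ℝ} (hs : 0 < s) {z : ℂ} (hz : 0 < z.re) :
    ∫ q in Set.Ioi (0 : ℝ), ((q ^ (s - 1) : ℝ) : ℂ) * Complex.exp (-z * q)
      = Real.Gamma s * z ^ (-(s : ℂ)) := by
  set U : Set ℂ := {z : ℂ | 0 < z.re} with hU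
  have hUo : IsOpen U := isOpen_lt continuous_const Complex.continuous_re
  have hUc : IsPreconnected U := (convex_halfSpace_re_gt 0).isPreconnected
  set F : ℂ → ℂ := fun z => ∫ q in Set.Ioi (0 : ℝ), ((q ^ (s - 1) : ℝ) : ℂ) * Complex.exp (-z * q)
  have hF : DifferentiableOn ℂ F U := by
    intro z hz
    have hz' : 0 < z.re := hz
    have key := hasDerivAt_integral_of_dominated_loc_of_deriv_le (𝕜 := ℂ)
      (μ := volume.restrict (Set.Ioi (0 : ℝ)))
      (F := fun z q => ((q ^ (s - 1) : ℝ) : ℂ) * Complex.exp (-z * q))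
      (F' := fun z q => ((q ^ (s - 1) : ℝ) : ℂ) * (Complex.exp (-z * q) * (-q)))
      (x₀ := z) (s := Metric.ball z (z.re / 2))
      (bound := fun q => q ^ (s + 1 - 1) * Real.exp (-(z.re / 2) * q))
      (Metric.ball_mem_nhds z (by positivity)) ?_ ?_ ?_ ?_ ?_ ?_
    · exact key.2.differentiableAt.differentiableWithinAt
    · exact Eventually.of_forall fun w => laplace_meas s w
    · exact laplace_integrable hs hz'
    · have := (laplace_meas s z).mul (g := fun q : ℝ => -(q : ℂ))
        (Measurable.aestronglyMeasurable (by fun_prop))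
      refine this.congr (Eventually.of_forall fun q => ?_)
      simp only [Pi.mul_apply]; ring
    · filter_upwards [ae_restrict_mem measurableSet_Ioi] with q hq w hw
      have hq' : (0 : ℝ) < q := hq
      rw [← mul_assoc, norm_mul, laplace_norm s w hq, norm_neg, Complex.norm_real,
        Real.norm_of_nonneg hq'.le]
      have e : q ^ (s + 1 - 1) = q ^ (s - 1) * q := by
        rw [← Real.rpow_add_one hq'.ne']; ring_nf
      rw [e]
      have hre : z.re / 2 ≤ w.re := by
        have h1 : ‖w - z‖ < z.re / 2 := by simpa [dist_eq_norm] using hw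
        have h2 := Complex.abs_re_le_norm (w - z)
        have h3 := (abs_le.1 h2).1
        simp at h3
        linarith
      have : Real.exp (-w.re * q) ≤ Real.exp (-(z.re / 2) * q) := by
        apply Real.exp_le_exp.2
        nlinarith
      calc q ^ (s - 1) * Real.exp (-w.re * q) * q ≤ q ^ (s - 1) * Real.exp (-(z.re / 2) * q) * q := by
            gcongr
        _ = _ := by ring
    · exact integrable_rpow_exp (by linarith) (by positivity)
    · filter_upwards with q w _
      have h1 : HasDerivAt (fun w : ℂ => -w * (q : ℂ)) (-(q : ℂ)) w := by
        simpa using ((hasDerivAt_id w).neg.mul_const (q : ℂ))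
      exact (h1.cexp).const_mul _
  have hG : DifferentiableOn ℂ (fun z : ℂ => Real.Gamma s * z ^ (-(s : ℂ))) U := by
    intro z hz
    have : z ∈ Complex.slitPlane := Or.inl hz
    exact ((differentiableAt_id.cpow_const this).const_mul _).differentiableWithinAt
  have hreal : ∀ x : ℝ, 0 < x → F x = Real.Gamma s * (x : ℂ) ^ (-(s : ℂ)) := by
    intro x hx
    have h1 := Real.integral_rpow_mul_exp_neg_mul_Ioi hs hx
    have h2 : F x = ((∫ t in Set.Ioi (0 : ℝ), t ^ (s - 1) * Real.exp (-(x * t)) : ℝ) : ℂ) := by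
      rw [← integral_complex_ofReal]
      refine integral_congr_ae (Eventually.of_forall fun q => ?_)
      push_cast
      simp only [neg_mul]
    rw [h2, h1, ← Complex.ofReal_neg, ← Complex.ofReal_cpow hx.le, Real.rpow_neg hx.le, one_div,
      Real.inv_rpow hx.le]
    push_cast
    ring
  have hone : (1 : ℂ) ∈ U := by simp [hU]
  have := (hF.analyticOnNhd hUo).eqOn_of_preconnected_of_frequently_eq
    (hG.analyticOnNhd hUo) hUc hone ?_
  · exact this hz
  · have ht : Tendsto (fun x : ℝ => (x : ℂ)) (𝓝[≠] 1) (𝓝[≠] 1) := by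
      apply tendsto_nhdsWithin_of_tendsto_nhds_of_eventually_within
      · have := Complex.continuous_ofReal.tendsto 1
        simpa using this.mono_left nhdsWithin_le_nhds
      · filter_upwards [self_mem_nhdsWithin] with x hx
        simpa using hx
    apply ht.frequently
    apply Eventually.frequently
    have : ∀ᶠ x : ℝ in 𝓝 1, 0 < x := eventually_gt_nhds one_pos
    filter_upwards [this.filter_mono nhdsWithin_le_nhds] with x hx
    exact hreal x hx


lemma ofReal_beta_integrand (α β : ℝ) {y : ℝ} (hy : y ∈ Set.Ioc (0 : ℝ) 1) :
    (y : ℂ) ^ ((α : ℂ) - 1) * (1 - (y : ℂ)) ^ ((β : ℂ) - 1)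
      = ((y ^ (α - 1) * (1 - y) ^ (β - 1) : ℝ) : ℂ) := by
  have h1 : (0 : ℝ) ≤ 1 - y := by linarith [hy.2]
  rw [Complex.ofReal_mul, Complex.ofReal_cpow hy.1.le, Complex.ofReal_cpow h1]
  push_cast
  rfl

lemma beta_integrable {α β : ℝ} (hα : 0 < α) (hβ : 0 < β) :
    IntegrableOn (fun y : ℝ => y ^ (α - 1) * (1 - y) ^ (β - 1)) (Set.Ioo 0 1) := by
  have h := Complex.betaIntegral_convergent (u := α) (v := β) (by simpa) (by simpa)
  rw [intervalIntegrable_iff_integrableOn_Ioc_of_le zero_le_one] at h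
  have h2 := Integrable.re h
  have h3 : IntegrableOn (fun y : ℝ => y ^ (α - 1) * (1 - y) ^ (β - 1)) (Set.Ioc 0 1) := by
    refine IntegrableOn.congr_fun h2 (fun y hy => ?_) measurableSet_Ioc
    rw [ofReal_beta_integrand α β hy]
    simp
  exact h3.mono_set Set.Ioo_subset_Ioc_self

lemma beta_value {α β : ℝ} (hα : 0 < α) (hβ : 0 < β) :
    ∫ y in Set.Ioo (0 : ℝ) 1, y ^ (α - 1) * (1 - y) ^ (β - 1)
      = Real.Gamma α * Real.Gamma β / Real.Gamma (α + β) := by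
  have h := Complex.Gamma_mul_Gamma_eq_betaIntegral (s := α) (t := β) (by simpa) (by simpa)
  have h2 : Complex.betaIntegral α β =
      ((∫ y in Set.Ioo (0 : ℝ) 1, y ^ (α - 1) * (1 - y) ^ (β - 1) : ℝ) : ℂ) := by
    unfold Complex.betaIntegral
    rw [intervalIntegral.integral_of_le zero_le_one, ← integral_Ioc_eq_integral_Ioo,
      ← integral_complex_ofReal]
    exact setIntegral_congr_fun measurableSet_Ioc fun y hy => ofReal_beta_integrand α β hy
  rw [h2, ← Complex.ofReal_add, Complex.Gamma_ofReal, Complex.Gamma_ofReal,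
    Complex.Gamma_ofReal] at h
  have h3 : Real.Gamma α * Real.Gamma β = Real.Gamma (α + β) *
    ∫ y in Set.Ioo (0 : ℝ) 1, y ^ (α - 1) * (1 - y) ^ (β - 1) := by exact_mod_cast h
  have h4 : Real.Gamma (α + β) ≠ 0 := (Real.Gamma_pos_of_pos (by linarith)).ne'
  rw [h3]
  field_simp

lemma subst_aux (n : ℕ) (β : ℝ) :
    Set.EqOn (fun x : ℝ => ((2 : ℝ) * x ^ ((2 : ℝ) - 1)) • (Set.indicator (Set.Ioo 0 1)
      (fun y : ℝ => y ^ (((n : ℝ) + 1 / 2) - 1) * (1 - y) ^ (β - 1))) (x ^ (2 : ℝ)))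
      (Set.indicator (Set.Ioo 0 1) (fun t : ℝ => 2 * ((1 - t ^ 2) ^ (β - 1) * t ^ (2 * n))))
      (Set.Ioi 0) := by
  intro x hx
  have hx' : (0 : ℝ) < x := hx
  by_cases h : x < 1
  · have h1 : x ^ (2 : ℝ) ∈ Set.Ioo (0 : ℝ) 1 := by
      rw [Real.rpow_two]
      constructor <;> nlinarith
    simp only
    rw [Set.indicator_of_mem h1, Set.indicator_of_mem (show x ∈ Set.Ioo (0 : ℝ) 1 from ⟨hx, h⟩)]
    have e : x * (x ^ (2 : ℝ)) ^ (((n : ℝ) + 1 / 2) - 1) = x ^ (2 * n) := by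
      rw [← Real.rpow_mul hx'.le]
      nth_rewrite 1 [← Real.rpow_one x]
      rw [← Real.rpow_add hx', ← Real.rpow_natCast]
      congr 1
      push_cast
      ring
    rw [← e, Real.rpow_two, show (2 : ℝ) - 1 = 1 by norm_num, Real.rpow_one, smul_eq_mul]
    ring
  · have h1 : x ^ (2 : ℝ) ∉ Set.Ioo (0 : ℝ) 1 := by
      rw [Real.rpow_two]
      rintro ⟨_, h2⟩
      nlinarith
    simp only
    rw [Set.indicator_of_notMem h1, Set.indicator_of_notMem (fun h2 => h h2.2)]
    simp

lemma ind_inter : Set.Ioi (0 : ℝ) ∩ Set.Ioo 0 1 = Set.Ioo 0 1 := by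
  ext x; simp

lemma moment (n : ℕ) {β : ℝ} (hβ : 0 < β) :
    ∫ t in Set.Ioo (0 : ℝ) 1, (1 - t ^ 2) ^ (β - 1) * t ^ (2 * n)
      = 1 / 2 * (Real.Gamma (n + 1 / 2) * Real.Gamma β / Real.Gamma (n + 1 / 2 + β)) := by
  have h := integral_comp_rpow_Ioi_of_pos (p := 2) (g := Set.indicator (Set.Ioo 0 1)
      (fun y : ℝ => y ^ (((n : ℝ) + 1 / 2) - 1) * (1 - y) ^ (β - 1))) two_pos
  rw [setIntegral_congr_fun measurableSet_Ioi (subst_aux n β),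
    setIntegral_indicator measurableSet_Ioo, setIntegral_indicator measurableSet_Ioo, ind_inter,
    integral_const_mul, beta_value (by positivity) hβ] at h
  linarith

lemma wgt_integrable {β : ℝ} (hβ : 0 < β) :
    IntegrableOn (fun t : ℝ => (1 - t ^ 2) ^ (β - 1)) (Set.Ioo 0 1) := by
  have h := (integrableOn_Ioi_comp_rpow_iff (p := 2) (Set.indicator (Set.Ioo 0 1)
      (fun y : ℝ => y ^ (((0 : ℕ) + 1 / 2 : ℝ) - 1) * (1 - y) ^ (β - 1))) two_ne_zero).2 ?_
  · rw [abs_of_pos (two_pos : (0 : ℝ) < 2)] at h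
    have h2 := h.congr_fun (subst_aux 0 β) measurableSet_Ioi
    rw [IntegrableOn, integrable_indicator_iff measurableSet_Ioo, IntegrableOn,
      Measure.restrict_restrict measurableSet_Ioo, Set.inter_comm, ind_inter] at h2
    have h3 := h2.const_mul (1 / 2)
    refine h3.congr (Eventually.of_forall fun t => ?_)
    simp
  · rw [IntegrableOn, integrable_indicator_iff measurableSet_Ioo, IntegrableOn,
      Measure.restrict_restrict measurableSet_Ioo, Set.inter_comm, ind_inter]
    exact beta_integrable (by norm_num) hβ

lemma gamma_half (n : ℕ) : Real.Gamma (n + 1 / 2) * (4 ^ n * n.factorial)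
    = (2 * n).factorial * Real.sqrt Real.pi := by
  induction n with
  | zero => simp [Real.Gamma_one_half_eq, -one_div]
  | succ n ih =>
    have e : ((n + 1 : ℕ) : ℝ) + 1 / 2 = ((n : ℝ) + 1 / 2) + 1 := by push_cast; ring
    rw [e, Real.Gamma_add_one (by positivity), Nat.factorial_succ,
      show 2 * (n + 1) = 2 * n + 1 + 1 by ring, Nat.factorial_succ, Nat.factorial_succ]
    push_cast
    rw [pow_succ]
    linear_combination (4 * (n + 1) * (n + 1 / 2) : ℝ) * ih

lemma gamma_asc {b : ℝ} (hb : 0 < b) (n : ℕ) :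
    Polynomial.eval (b : ℂ) (ascPochhammer ℂ n) * Real.Gamma b = Real.Gamma (n + b) := by
  induction n with
  | zero => simp
  | succ n ih =>
    rw [ascPochhammer_succ_eval,
      show ((n + 1 : ℕ) : ℝ) + b = (n + b) + 1 by push_cast; ring,
      Real.Gamma_add_one (by positivity)]
    push_cast
    rw [← ih]
    ring

/-- Poisson integral for `₀F₁`. -/
lemma poisson {β : ℝ} (hβ : 0 < β) (w : ℂ) :
    ∫ t in Set.Ioo (0 : ℝ) 1, (((1 - t ^ 2) ^ (β - 1) : ℝ) : ℂ) * Complex.cosh (2 * w * t)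
      = Real.sqrt Real.pi * Real.Gamma β / (2 * Real.Gamma (1 / 2 + β))
          * ps (coG ((1 / 2 + β : ℝ) : ℂ)) (w ^ 2) := by
  have hb : 0 < 1 / 2 + β := by linarith
  have hwm : Measurable (fun t : ℝ => (((1 - t ^ 2) ^ (β - 1) : ℝ) : ℂ)) := by
    apply Complex.measurable_ofReal.comp
    fun_prop
  have h1 := hasSum_integral_of_dominated_convergence
    (μ := volume.restrict (Set.Ioo (0 : ℝ) 1))
    (F := fun (n : ℕ) (t : ℝ) => (((1 - t ^ 2) ^ (β - 1) : ℝ) : ℂ) *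
      ((2 * w * t) ^ (2 * n) / ((2 * n).factorial : ℂ)))
    (f := fun t => (((1 - t ^ 2) ^ (β - 1) : ℝ) : ℂ) * Complex.cosh (2 * w * t))
    (fun n t => (1 - t ^ 2) ^ (β - 1) * ((2 * ‖w‖) ^ (2 * n) / ((2 * n).factorial : ℝ)))
    ?_ ?_ ?_ ?_ ?_
  · have hG0 : (Real.Gamma (1 / 2 + β) : ℂ) ≠ 0 := by
      exact_mod_cast (Real.Gamma_pos_of_pos hb).ne'
    have h2 := ((ent_coG hb).summable (w ^ 2)).hasSum.mul_left
      ((Real.sqrt Real.pi * Real.Gamma β / (2 * Real.Gamma (1 / 2 + β)) : ℂ))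
    refine h1.unique ?_
    refine (congrArg (fun F => HasSum F _) (funext fun n => ?_)).mpr h2
    have e1 : ∫ t in Set.Ioo (0 : ℝ) 1, (((1 - t ^ 2) ^ (β - 1) : ℝ) : ℂ) *
        ((2 * w * t) ^ (2 * n) / ((2 * n).factorial : ℂ))
        = (2 * w) ^ (2 * n) / ((2 * n).factorial : ℂ) *
          ((∫ t in Set.Ioo (0 : ℝ) 1, (1 - t ^ 2) ^ (β - 1) * t ^ (2 * n) : ℝ) : ℂ) := by
      rw [← integral_complex_ofReal, ← integral_const_mul]
      refine integral_congr_ae (Eventually.of_forall fun t => ?_)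
      simp only
      push_cast
      rw [mul_pow (2 * w) (t : ℂ)]
      ring
    rw [e1, moment n hβ, add_assoc]
    have k1 := gamma_half n
    have k2 := gamma_asc hb n
    have k0 := asc_ne hb n
    have k3 : (n.factorial : ℂ) ≠ 0 := by exact_mod_cast n.factorial_ne_zero
    have k4 : ((2 * n).factorial : ℂ) ≠ 0 := by exact_mod_cast (2 * n).factorial_ne_zero
    have k5 : (Real.Gamma (n + 1 / 2) : ℂ) = (2 * n).factorial * Real.sqrt Real.pi /
        (4 ^ n * n.factorial) := by
      rw [eq_div_iff (mul_ne_zero (pow_ne_zero _ (by norm_num)) k3)]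
      exact_mod_cast k1
    unfold coG
    simp only [Complex.ofReal_mul, Complex.ofReal_div]
    rw [← k2, k5, mul_pow, pow_mul (2 : ℂ), pow_mul w]
    push_cast at k0 hG0 ⊢
    norm_num
    field_simp
  · intro n
    exact (hwm.mul (by fun_prop)).aestronglyMeasurable
  · intro n
    filter_upwards [ae_restrict_mem measurableSet_Ioo] with t ht
    have h0 : (0 : ℝ) ≤ 1 - t ^ 2 := by nlinarith [ht.1, ht.2]
    rw [norm_mul, Complex.norm_real, Real.norm_of_nonneg (by positivity), norm_div, norm_pow,
      norm_mul, norm_mul, Complex.norm_real, Complex.norm_natCast, Real.norm_of_nonneg ht.1.le]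
    have : 2 * ‖w‖ * t ≤ 2 * ‖w‖ := by
      have := norm_nonneg w
      nlinarith [ht.2]
    have ht0 := ht.1
    simp only [Complex.norm_ofNat]
    gcongr
  · filter_upwards with t
    exact ((Real.hasSum_cosh (2 * ‖w‖)).summable).mul_left _
  · simp_rw [tsum_mul_left]
    exact (wgt_integrable hβ).mul_const _
  · filter_upwards with t
    exact (Complex.hasSum_cosh (2 * w * t)).mul_left _


lemma shift_int {β : ℝ} {T : ℝ} (hT : 0 < T) :
    ((T ^ β : ℝ) : ℂ) * ∫ t in Set.Ioo (0 : ℝ) 1, (((1 - t ^ 2) ^ (β - 1) : ℝ) : ℂ) *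
        Complex.exp (-(1 + Complex.I) * (T * (1 - t)))
      = ∫ q in Set.Ioi (0 : ℝ), Set.indicator (Set.Ioc 0 T) (fun q : ℝ =>
          (((2 - q / T) ^ (β - 1) : ℝ) : ℂ) * (((q ^ (β - 1) : ℝ) : ℂ)
            * Complex.exp (-(1 + Complex.I) * q))) q := by
  have h := intervalIntegral.integral_comp_sub_div (a := 0) (b := T) (c := T)
    (fun t : ℝ => (((1 - t ^ 2) ^ (β - 1) : ℝ) : ℂ) *
        Complex.exp (-(1 + Complex.I) * (T * (1 - t)))) hT.ne' 1
  rw [div_self hT.ne', zero_div, sub_self, sub_zero, intervalIntegral.integral_of_le hT.le,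
    intervalIntegral.integral_of_le zero_le_one, integral_Ioc_eq_integral_Ioo (x := (0 : ℝ)) (y := 1)]
    at h
  have e1 : Set.Ioi (0 : ℝ) ∩ Set.Ioc 0 T = Set.Ioc 0 T := by
    ext x; simp
  rw [setIntegral_indicator measurableSet_Ioc, e1]
  have e2 : (T ^ β : ℝ) = T ^ (β - 1) * T := by
    rw [← Real.rpow_add_one hT.ne']; ring_nf
  rw [e2, Complex.ofReal_mul, mul_assoc]
  rw [Complex.real_smul] at h
  rw [← h, ← integral_const_mul]
  refine setIntegral_congr_fun measurableSet_Ioc fun q hq => ?_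
  have hq0 : 0 < q := hq.1
  have hq1 : q / T ≤ 1 := by rw [div_le_one hT]; exact hq.2
  have e3 : 1 - (1 - q / T) ^ 2 = (q / T) * (2 - q / T) := by ring
  have e4 : (T : ℝ) ^ (β - 1) * (q / T) ^ (β - 1) = q ^ (β - 1) := by
    rw [← Real.mul_rpow hT.le (by positivity)]
    congr 1
    field_simp
  have e5 : (T : ℂ) * (1 - ((1 - q / T : ℝ) : ℂ)) = q := by
    have : (T : ℂ) ≠ 0 := by exact_mod_cast hT.ne'
    push_cast
    field_simp
    ring
  rw [e3, Real.mul_rpow (by positivity) (by linarith), e5, ← e4]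
  push_cast
  ring

lemma rpow_bd {β x : ℝ} (h1 : 1 ≤ x) (h2 : x ≤ 2) : x ^ (β - 1) ≤ 2 ^ |β - 1| :=
  (Real.rpow_le_rpow_of_exponent_le h1 (le_abs_self _)).trans
    (Real.rpow_le_rpow (by linarith) h2 (abs_nonneg _))

lemma main_lim {β : ℝ} (hβ : 0 < β) :
    Tendsto (fun T : ℝ => ((T ^ β : ℝ) : ℂ) * ∫ t in Set.Ioo (0 : ℝ) 1,
      (((1 - t ^ 2) ^ (β - 1) : ℝ) : ℂ) * Complex.exp (-(1 + Complex.I) * (T * (1 - t))))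
      atTop (𝓝 ((2 ^ (β - 1) : ℝ) * (Real.Gamma β * (1 + Complex.I) ^ (-(β : ℂ))))) := by
  have hI : (0 : ℝ) < (1 + Complex.I).re := by simp
  rw [← laplace_gamma hβ hI, ← integral_const_mul]
  have key := tendsto_integral_filter_of_dominated_convergence (l := (atTop : Filter ℝ))
    (μ := volume.restrict (Set.Ioi (0 : ℝ)))
    (F := fun (T : ℝ) (q : ℝ) => Set.indicator (Set.Ioc 0 T) (fun q : ℝ =>
          (((2 - q / T) ^ (β - 1) : ℝ) : ℂ) * (((q ^ (β - 1) : ℝ) : ℂ)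
            * Complex.exp (-(1 + Complex.I) * q))) q)
    (f := fun q => ((2 ^ (β - 1) : ℝ) : ℂ) * (((q ^ (β - 1) : ℝ) : ℂ)
            * Complex.exp (-(1 + Complex.I) * q)))
    (fun q => 2 ^ |β - 1| * (q ^ (β - 1) * Real.exp (-1 * q))) ?_ ?_ ?_ ?_
  · refine key.congr' ?_
    filter_upwards [eventually_gt_atTop 0] with T hT
    exact (shift_int hT).symm
  · filter_upwards [eventually_gt_atTop 0] with T hT
    apply Measurable.aestronglyMeasurable
    refine Measurable.indicator ?_ measurableSet_Ioc
    have m1 : Measurable (fun q : ℝ => (2 - q / T) ^ (β - 1)) := by fun_prop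
    have m2 : Measurable (fun q : ℝ => q ^ (β - 1)) := by fun_prop
    exact (Complex.measurable_ofReal.comp m1).mul
      ((Complex.measurable_ofReal.comp m2).mul (by fun_prop))
  · filter_upwards [eventually_gt_atTop 0] with T hT
    filter_upwards [ae_restrict_mem measurableSet_Ioi] with q hq
    have hq0 : (0 : ℝ) < q := hq
    by_cases h : q ∈ Set.Ioc 0 T
    · rw [Set.indicator_of_mem h, norm_mul, laplace_norm β _ hq0]
      have hq1 : q / T ≤ 1 := by rw [div_le_one hT]; exact h.2
      have hq2 : 0 ≤ q / T := by positivity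
      have h0 : (0 : ℝ) ≤ (2 - q / T) ^ (β - 1) := Real.rpow_nonneg (by linarith) _
      rw [Complex.norm_real, Real.norm_of_nonneg h0]
      have := rpow_bd (β := β) (x := 2 - q / T) (by linarith) (by linarith)
      simp only [Complex.add_re, Complex.one_re, Complex.I_re, add_zero]
      gcongr
    · rw [Set.indicator_of_notMem h, norm_zero]
      positivity
  · exact (integrable_rpow_exp hβ one_pos).const_mul _
  · filter_upwards [ae_restrict_mem measurableSet_Ioi] with q hq
    have hq0 : (0 : ℝ) < q := hq
    have h1 : Tendsto (fun T : ℝ => (2 - q / T) ^ (β - 1)) atTop (𝓝 (2 ^ (β - 1))) := by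
      have h2 : Tendsto (fun T : ℝ => 2 - q / T) atTop (𝓝 (2 - 0)) :=
        tendsto_const_nhds.sub (tendsto_const_nhds.div_atTop tendsto_id)
      rw [sub_zero] at h2
      exact h2.rpow_const (Or.inl two_ne_zero)
    have h3 : Tendsto (fun T : ℝ => (((2 - q / T) ^ (β - 1) : ℝ) : ℂ) * (((q ^ (β - 1) : ℝ) : ℂ)
            * Complex.exp (-(1 + Complex.I) * q))) atTop
        (𝓝 (((2 ^ (β - 1) : ℝ) : ℂ) * (((q ^ (β - 1) : ℝ) : ℂ)
            * Complex.exp (-(1 + Complex.I) * q)))) :=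
      ((Complex.continuous_ofReal.tendsto _).comp h1).mul_const _
    refine h3.congr' ?_
    filter_upwards [eventually_ge_atTop q] with T hT
    rw [Set.indicator_of_mem (show q ∈ Set.Ioc 0 T from ⟨hq0, hT⟩)]

lemma small_lim {β : ℝ} (hβ : 0 < β) :
    Tendsto (fun T : ℝ => ((T ^ β : ℝ) : ℂ) * ∫ t in Set.Ioo (0 : ℝ) 1,
      (((1 - t ^ 2) ^ (β - 1) : ℝ) : ℂ) * Complex.exp (-(1 + Complex.I) * (T * (1 + t))))
      atTop (𝓝 0) := by
  set M := ∫ t in Set.Ioo (0 : ℝ) 1, (1 - t ^ 2) ^ (β - 1) with hM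
  have h1 : Tendsto (fun T : ℝ => (T ^ β * Real.exp (-1 * T)) * M) atTop (𝓝 (0 * M)) :=
    (tendsto_rpow_mul_exp_neg_mul_atTop_nhds_zero β 1 one_pos).mul_const M
  rw [zero_mul] at h1
  refine squeeze_zero_norm' ?_ h1
  filter_upwards [eventually_gt_atTop 0] with T hT
  rw [norm_mul, Complex.norm_real, Real.norm_of_nonneg (by positivity), mul_assoc]
  gcongr
  rw [hM, ← integral_const_mul]
  refine norm_integral_le_of_norm_le ((wgt_integrable hβ).const_mul _) ?_
  filter_upwards [ae_restrict_mem measurableSet_Ioo] with t ht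
  have h0 : (0 : ℝ) ≤ 1 - t ^ 2 := by nlinarith [ht.1, ht.2]
  rw [norm_mul, Complex.norm_real, Real.norm_of_nonneg (by positivity), Complex.norm_exp, mul_comm]
  gcongr
  simp
  nlinarith [ht.1]

/-- The limit constant. -/
def Lim (b : ℝ) : ℂ :=
  Real.Gamma b / (2 * Real.sqrt Real.pi) * (2 ^ (b - 1 / 2) : ℝ) *
    (1 + Complex.I) ^ (-((b - 1 / 2 : ℝ) : ℂ))

/-- The normalised function. -/
def Nrm (b T : ℝ) : ℂ :=
  ps (coG (b : ℂ)) (Complex.I * ((T ^ 2 / 2 : ℝ) : ℂ)) * Complex.exp (-(1 + Complex.I) * T)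
    * ((T ^ (b - 1 / 2) : ℝ) : ℂ)

lemma exp_int {β : ℝ} (hβ : 0 < β) (z c : ℂ) : IntegrableOn
    (fun t : ℝ => (((1 - t ^ 2) ^ (β - 1) : ℝ) : ℂ) * Complex.exp (z + c * t)) (Set.Ioo 0 1) := by
  refine Integrable.mono' ((wgt_integrable hβ).mul_const (Real.exp (‖z‖ + ‖c‖))) ?_ ?_
  · have m1 : Measurable (fun t : ℝ => (1 - t ^ 2) ^ (β - 1)) := by fun_prop
    exact ((Complex.measurable_ofReal.comp m1).mul (by fun_prop)).aestronglyMeasurable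
  · filter_upwards [ae_restrict_mem measurableSet_Ioo] with t ht
    have h0 : (0 : ℝ) ≤ 1 - t ^ 2 := by nlinarith [ht.1, ht.2]
    rw [norm_mul, Complex.norm_real, Real.norm_of_nonneg (by positivity), Complex.norm_exp]
    gcongr
    refine (Complex.re_le_norm _).trans ((norm_add_le _ _).trans ?_)
    gcongr
    rw [norm_mul, Complex.norm_real, Real.norm_of_nonneg ht.1.le]
    nlinarith [norm_nonneg c, ht.2]

lemma nrm_lim_half {β : ℝ} (hβ : 0 < β) :
    Tendsto (Nrm (1 / 2 + β)) atTop (𝓝 (Lim (1 / 2 + β))) := by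
  have hG1 : (Real.Gamma (1 / 2 + β) : ℂ) ≠ 0 := by
    exact_mod_cast (Real.Gamma_pos_of_pos (by linarith)).ne'
  have hG2 : (Real.Gamma β : ℂ) ≠ 0 := by
    exact_mod_cast (Real.Gamma_pos_of_pos hβ).ne'
  have hp : (Real.sqrt Real.pi : ℂ) ≠ 0 := by
    exact_mod_cast (Real.sqrt_pos.2 Real.pi_pos).ne'
  have h := ((main_lim hβ).add (small_lim hβ)).const_mul
    (((Real.Gamma (1 / 2 + β) : ℂ)) / (Real.sqrt Real.pi * Real.Gamma β))
  have eL : Lim (1 / 2 + β) = ((Real.Gamma (1 / 2 + β) : ℂ)) / (Real.sqrt Real.pi * Real.Gamma β) *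
      ((2 ^ (β - 1) : ℝ) * (Real.Gamma β * (1 + Complex.I) ^ (-(β : ℂ))) + 0) := by
    unfold Lim
    have e1 : (1 / 2 + β - 1 / 2 : ℝ) = β := by ring
    have e2 : (2 : ℝ) ^ β = 2 ^ (β - 1) * 2 := by
      rw [← Real.rpow_add_one two_ne_zero]; ring_nf
    rw [e1, e2]
    push_cast
    field_simp
    ring
  rw [eL]
  refine h.congr fun T => ?_
  have hP := poisson hβ ((1 + Complex.I) * T / 2)
  have e3 : ((1 + Complex.I) * T / 2) ^ 2 = Complex.I * ((T ^ 2 / 2 : ℝ) : ℂ) := by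
    push_cast
    linear_combination (T : ℂ) ^ 2 / 4 * Complex.I_sq
  rw [e3] at hP
  unfold Nrm
  have e1 : (1 / 2 + β - 1 / 2 : ℝ) = β := by ring
  have e4 : ps (coG ((1 / 2 + β : ℝ) : ℂ)) (Complex.I * ((T ^ 2 / 2 : ℝ) : ℂ)) =
    (2 * Real.Gamma (1 / 2 + β)) / (Real.sqrt Real.pi * Real.Gamma β) * ∫ t in Set.Ioo (0 : ℝ) 1,
      (((1 - t ^ 2) ^ (β - 1) : ℝ) : ℂ) * Complex.cosh (2 * ((1 + Complex.I) * T / 2) * t) := by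
    rw [hP]
    clear e1
    generalize (Real.Gamma (1 / 2 + β) : ℂ) = g at hG1 ⊢
    field_simp
  rw [e4, e1, ← mul_add]
  have e5 : (∫ t in Set.Ioo (0 : ℝ) 1,
      (((1 - t ^ 2) ^ (β - 1) : ℝ) : ℂ) * Complex.exp (-(1 + Complex.I) * (T * (1 - t)))) +
      ∫ t in Set.Ioo (0 : ℝ) 1,
      (((1 - t ^ 2) ^ (β - 1) : ℝ) : ℂ) * Complex.exp (-(1 + Complex.I) * (T * (1 + t)))
      = 2 * Complex.exp (-(1 + Complex.I) * T) * ∫ t in Set.Ioo (0 : ℝ) 1,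
      (((1 - t ^ 2) ^ (β - 1) : ℝ) : ℂ) * Complex.cosh (2 * ((1 + Complex.I) * T / 2) * t) := by
    rw [← integral_add, ← integral_const_mul]
    · refine integral_congr_ae (Eventually.of_forall fun t => ?_)
      simp only [Complex.cosh]
      have f1 : Complex.exp (-(1 + Complex.I) * (T * (1 - t))) =
        Complex.exp (-(1 + Complex.I) * T) * Complex.exp (2 * ((1 + Complex.I) * T / 2) * t) := by
        rw [← Complex.exp_add]; congr 1; ring
      have f2 : Complex.exp (-(1 + Complex.I) * (T * (1 + t))) =
        Complex.exp (-(1 + Complex.I) * T) * Complex.exp (-(2 * ((1 + Complex.I) * T / 2) * t)) := by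
        rw [← Complex.exp_add]; congr 1; ring
      rw [f1, f2]
      ring
    · refine (exp_int hβ (-(1 + Complex.I) * T) ((1 + Complex.I) * T)).congr
        (Eventually.of_forall fun t => ?_)
      simp only
      congr 2
      ring
    · refine (exp_int hβ (-(1 + Complex.I) * T) (-(1 + Complex.I) * T)).congr
        (Eventually.of_forall fun t => ?_)
      simp only
      congr 2
      ring
  rw [e5]
  field_simp

lemma nrm_lim {b : ℝ} (hb : 0 < b) : Tendsto (Nrm b) atTop (𝓝 (Lim b)) := by
  have h1 := nrm_lim_half (β := b + 1 / 2) (by linarith)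
  have h2 := nrm_lim_half (β := b + 3 / 2) (by linarith)
  rw [show 1 / 2 + (b + 1 / 2) = b + 1 by ring] at h1
  rw [show 1 / 2 + (b + 3 / 2) = b + 2 by ring] at h2
  have h0 : Tendsto (fun T : ℝ => ((T : ℝ) : ℂ)⁻¹) atTop (𝓝 0) := by
    have := (Complex.continuous_ofReal.tendsto 0).comp tendsto_inv_atTop_zero
    simpa [Function.comp_def] using this
  have h := (h0.mul h1).add (h2.const_mul (Complex.I / (2 * (b * (b + 1)))))
  have hb0 : (b : ℂ) ≠ 0 := by exact_mod_cast hb.ne'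
  have hb1 : (b : ℂ) + 1 ≠ 0 := by exact_mod_cast (by positivity : b + 1 ≠ 0)
  have hI : (1 + Complex.I) ≠ 0 := by
    intro h; simpa using congrArg Complex.re h
  have eL : Lim b = 0 * Lim (b + 1) + Complex.I / (2 * (b * (b + 1))) * Lim (b + 2) := by
    unfold Lim
    have e1 : Real.Gamma (b + 2) = (b + 1) * (b * Real.Gamma b) := by
      rw [show b + 2 = b + 1 + 1 by ring, Real.Gamma_add_one (by positivity),
        Real.Gamma_add_one hb.ne']
    have e2 : (2 : ℝ) ^ (b + 2 - 1 / 2) = 2 ^ (b - 1 / 2) * 4 := by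
      rw [show b + 2 - 1 / 2 = (b - 1 / 2) + (2 : ℕ) by push_cast; ring,
        Real.rpow_add_natCast two_ne_zero]
      norm_num
    have e3 : (1 + Complex.I) ^ (-((b - 1 / 2 : ℝ) : ℂ))
        = (1 + Complex.I) ^ (-((b + 2 - 1 / 2 : ℝ) : ℂ)) * (2 * Complex.I) := by
      rw [show -((b - 1 / 2 : ℝ) : ℂ) = -((b + 2 - 1 / 2 : ℝ) : ℂ) + (2 : ℕ) by push_cast; ring,
        Complex.cpow_add _ _ hI, Complex.cpow_natCast]
      congr 1
      linear_combination Complex.I_sq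
    rw [e1, e2, e3]
    push_cast
    field_simp
    ring
  rw [eL]
  refine h.congr' ?_
  filter_upwards [eventually_gt_atTop 0] with T hT
  unfold Nrm
  have hT0 : (T : ℂ) ≠ 0 := by exact_mod_cast hT.ne'
  rw [G_contig hb]
  have e1 : T ^ (b + 1 - 1 / 2) = T ^ (b - 1 / 2) * T := by
    rw [← Real.rpow_add_one hT.ne']; ring_nf
  have e2 : T ^ (b + 2 - 1 / 2) = T ^ (b - 1 / 2) * T ^ 2 := by
    rw [show b + 2 - 1 / 2 = (b - 1 / 2) + (2 : ℕ) by push_cast; ring,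
        Real.rpow_add_natCast hT.ne']
  rw [e1, e2]
  push_cast
  field_simp


lemma ps_zero (c : ℕ → ℂ) : ps c 0 = c 0 := by
  unfold ps
  rw [tsum_eq_single 0]
  · simp
  · intro n hn; simp [hn]

section gfun
variable (b μ : ℝ)

/-- Comparison function. -/
def gg (y : ℝ) : ℂ := ps (coG (b : ℂ)) (Complex.I * ((μ * y : ℝ) : ℂ))
/-- Its first derivative. -/
def gg1 (y : ℝ) : ℂ := Complex.I * μ * ps (dco (coG (b : ℂ))) (Complex.I * ((μ * y : ℝ) : ℂ))
/-- Its second derivative. -/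
def gg2 (y : ℝ) : ℂ :=
  (Complex.I * μ) ^ 2 * ps (dco (dco (coG (b : ℂ)))) (Complex.I * ((μ * y : ℝ) : ℂ))

variable {b μ}

lemma lin_deriv (y : ℝ) : HasDerivAt (fun y : ℝ => Complex.I * ((μ * y : ℝ) : ℂ))
    (Complex.I * μ) y := by
  have h1 : HasDerivAt (fun y : ℝ => μ * y) μ y := by
    simpa using (hasDerivAt_id y).const_mul μ
  exact h1.ofReal_comp.const_mul Complex.I

lemma gg_deriv (hb : 0 < b) (y : ℝ) : HasDerivAt (gg b μ) (gg1 b μ y) y := by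
  have h := HasDerivAt.comp y ((ent_coG hb).hasDerivAt (Complex.I * ((μ * y : ℝ) : ℂ)))
    (lin_deriv (μ := μ) y)
  rw [mul_comm] at h
  exact h

lemma gg1_deriv (hb : 0 < b) (y : ℝ) : HasDerivAt (gg1 b μ) (gg2 b μ y) y := by
  have h := (HasDerivAt.comp y ((ent_coG hb).dco.hasDerivAt (Complex.I * ((μ * y : ℝ) : ℂ)))
    (lin_deriv (μ := μ) y)).const_mul (Complex.I * μ)
  have e : gg2 b μ y = Complex.I * μ * (ps (dco (dco (coG (b : ℂ))))
    (Complex.I * ((μ * y : ℝ) : ℂ)) * (Complex.I * μ)) := by unfold gg2; ring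
  rw [e]
  exact h

lemma gg_ode (hb : 0 < b) (y : ℝ) :
    (y : ℂ) * gg2 b μ y + b * gg1 b μ y = Complex.I * μ * gg b μ y := by
  have h := ps_ode hb (coG_rec hb) (Complex.I * ((μ * y : ℝ) : ℂ))
  unfold gg gg1 gg2
  push_cast at h ⊢
  linear_combination (Complex.I * μ) * h

lemma gg_zero : gg b μ 0 = 1 := by
  unfold gg
  simp [ps_zero, coG]

end gfun

lemma G_ne {b : ℝ} (hb : 0 < b) {r : ℝ} (hr : 0 ≤ r) :
    ps (coG (b : ℂ)) (Complex.I * (r : ℂ)) ≠ 0 := by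
  have h := g_ne_zero hb one_pos (gg_deriv (μ := 1) hb) (gg1_deriv hb)
    (fun y _ => gg_ode hb y) gg_zero hr
  simpa [gg] using h

lemma Lim_ne {b : ℝ} (hb : 0 < b) : Lim b ≠ 0 := by
  have h1 : (Real.Gamma b : ℂ) ≠ 0 := by exact_mod_cast (Real.Gamma_pos_of_pos hb).ne'
  have hp : (Real.sqrt Real.pi : ℂ) ≠ 0 := by
    exact_mod_cast (Real.sqrt_pos.2 Real.pi_pos).ne'
  have h2 : ((2 ^ (b - 1 / 2) : ℝ) : ℂ) ≠ 0 := by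
    exact_mod_cast (Real.rpow_pos_of_pos two_pos _).ne'
  have hI : (1 + Complex.I) ≠ 0 := by
    intro h; simpa using congrArg Complex.re h
  unfold Lim
  refine mul_ne_zero (mul_ne_zero (div_ne_zero h1 (mul_ne_zero two_ne_zero hp)) h2) ?_
  rw [Ne, Complex.cpow_eq_zero_iff]
  tauto

lemma ratio_lim {b : ℝ} (hb : 0 < b) :
    Tendsto (fun T : ℝ => ‖ps (dco (coG (b : ℂ))) (Complex.I * ((T ^ 2 / 2 : ℝ) : ℂ))
      / ps (coG (b : ℂ)) (Complex.I * ((T ^ 2 / 2 : ℝ) : ℂ))‖) atTop (𝓝 0) := by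
  have h0 : Tendsto (fun T : ℝ => ((T : ℝ) : ℂ)⁻¹) atTop (𝓝 0) := by
    have := (Complex.continuous_ofReal.tendsto 0).comp tendsto_inv_atTop_zero
    simpa [Function.comp_def] using this
  have h1 := ((nrm_lim (show 0 < b + 1 by positivity)).div (nrm_lim hb) (Lim_ne hb)).mul
    (h0.const_mul (1 / (b : ℂ)))
  simp only [mul_zero] at h1
  have h2 := h1.norm
  rw [norm_zero] at h2
  refine h2.congr' ?_
  filter_upwards [eventually_gt_atTop 0] with T hT
  congr 1
  rw [dco_coG hb]
  have hT0 : (T : ℂ) ≠ 0 := by exact_mod_cast hT.ne'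
  have hb0 : (b : ℂ) ≠ 0 := by exact_mod_cast hb.ne'
  have e1 : T ^ (b + 1 - 1 / 2) = T ^ (b - 1 / 2) * T := by
    rw [← Real.rpow_add_one hT.ne']; ring_nf
  have e2 : ((T ^ (b - 1 / 2) : ℝ) : ℂ) ≠ 0 := by
    exact_mod_cast (Real.rpow_pos_of_pos hT _).ne'
  have e3 := G_ne hb (show 0 ≤ T ^ 2 / 2 by positivity)
  have e4 := Complex.exp_ne_zero (-(1 + Complex.I) * T)
  simp only [Pi.div_apply]
  unfold Nrm
  rw [e1, Complex.ofReal_mul]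
  clear e1
  generalize ((T ^ (b - 1 / 2) : ℝ) : ℂ) = g at e2 ⊢
  field_simp

lemma ratio_small {b : ℝ} (hb : 0 < b) {η : ℝ} (hη : 0 < η) : ∃ r0 : ℝ, 0 ≤ r0 ∧ ∀ r : ℝ, r0 ≤ r →
    ‖ps (dco (coG (b : ℂ))) (Complex.I * (r : ℂ))‖ ≤ η * ‖ps (coG (b : ℂ)) (Complex.I * (r : ℂ))‖ := by
  have h := (ratio_lim hb).eventually_le_const hη
  obtain ⟨T0, hT0⟩ := eventually_atTop.1 h
  refine ⟨(max T0 0) ^ 2 / 2, by positivity, fun r hr => ?_⟩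
  have hr0 : 0 ≤ r := le_trans (by positivity) hr
  have h1 : max T0 0 ≤ Real.sqrt (2 * r) := Real.le_sqrt_of_sq_le (by linarith)
  have h2 := hT0 _ ((le_max_left _ _).trans h1)
  rw [Real.sq_sqrt (by positivity), mul_div_cancel_left₀ _ (two_ne_zero), norm_div,
    div_le_iff₀ (norm_pos_iff.2 (G_ne hb hr0))] at h2
  exact h2

lemma ratio_bdd {b : ℝ} (hb : 0 < b) : ∃ A : ℝ, 0 ≤ A ∧ ∀ r : ℝ, 0 ≤ r →
    ‖ps (dco (coG (b : ℂ))) (Complex.I * (r : ℂ))‖ ≤ A * ‖ps (coG (b : ℂ)) (Complex.I * (r : ℂ))‖ := by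
  obtain ⟨r0, hr0, h⟩ := ratio_small hb one_pos
  have c1 : Continuous (ps (coG (b : ℂ))) :=
    continuous_iff_continuousAt.2 fun y => ((ent_coG hb).hasDerivAt y).continuousAt
  have c2 : Continuous (ps (dco (coG (b : ℂ)))) :=
    continuous_iff_continuousAt.2 fun y => ((ent_coG hb).dco.hasDerivAt y).continuousAt
  have hc : ContinuousOn (fun r : ℝ => ps (dco (coG (b : ℂ))) (Complex.I * (r : ℂ)) /
      ps (coG (b : ℂ)) (Complex.I * (r : ℂ))) (Set.Icc 0 r0) :=
    ContinuousOn.div (by fun_prop) (by fun_prop) fun r hr => G_ne hb hr.1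
  obtain ⟨C, hC⟩ := isCompact_Icc.exists_bound_of_continuousOn hc
  refine ⟨max C 1, by positivity, fun r hr => ?_⟩
  rcases le_total r r0 with h1 | h1
  · have h2 := hC r ⟨hr, h1⟩
    rw [norm_div, div_le_iff₀ (norm_pos_iff.2 (G_ne hb hr))] at h2
    refine h2.trans ?_
    gcongr
    exact le_max_left _ _
  · refine (h r h1).trans ?_
    gcongr
    exact le_max_right _ _

section ffun
variable (b : ℝ) (x : ℂ)

/-- Liouville-transformed Kummer function. -/
def ff (y : ℝ) : ℂ := Complex.exp (-(y : ℂ) / 2) * ps (coF x b) y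
/-- Its first derivative. -/
def ff1 (y : ℝ) : ℂ := Complex.exp (-(y : ℂ) / 2) * (ps (dco (coF x b)) y - ps (coF x b) y / 2)
/-- Its second derivative. -/
def ff2 (y : ℝ) : ℂ := Complex.exp (-(y : ℂ) / 2) *
  (ps (dco (dco (coF x b))) y - ps (dco (coF x b)) y + ps (coF x b) y / 4)

variable {b x}

lemma exph_deriv (y : ℝ) : HasDerivAt (fun y : ℝ => Complex.exp (-(y : ℂ) / 2))
    (Complex.exp (-(y : ℂ) / 2) * (-1 / 2)) y := by
  have h1 : HasDerivAt (fun y : ℝ => -(y : ℂ) / 2) (-1 / 2) y :=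
    ((hasDerivAt_id y).ofReal_comp.neg).div_const 2
  exact h1.cexp

lemma ff_deriv (hb : 0 < b) (y : ℝ) : HasDerivAt (ff b x) (ff1 b x y) y := by
  have h := (exph_deriv y).mul ((ent_of_rec hb (coF_rec hb x)).hasDerivAt (y : ℂ)).comp_ofReal
  have e : ff1 b x y = Complex.exp (-(y : ℂ) / 2) * (-1 / 2) * ps (coF x b) y +
    Complex.exp (-(y : ℂ) / 2) * ps (dco (coF x b)) y := by unfold ff1; ring
  rw [e]
  exact h

lemma ff1_deriv (hb : 0 < b) (y : ℝ) : HasDerivAt (ff1 b x) (ff2 b x y) y := by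
  have hE := ent_of_rec hb (coF_rec hb x)
  have h := (exph_deriv y).mul ((hE.dco.hasDerivAt (y : ℂ)).comp_ofReal.sub
    ((hE.hasDerivAt (y : ℂ)).comp_ofReal.div_const 2))
  have e : ff2 b x y = Complex.exp (-(y : ℂ) / 2) * (-1 / 2) *
      (ps (dco (coF x b)) y - ps (coF x b) y / 2) +
    Complex.exp (-(y : ℂ) / 2) * (ps (dco (dco (coF x b))) y - ps (dco (coF x b)) y / 2) := by
      unfold ff2; ring
  rw [e]
  exact h

lemma ff_ode (hb : 0 < b) (y : ℝ) :
    (y : ℂ) * ff2 b x y + b * ff1 b x y = (x - b / 2 + y / 4) * ff b x y := by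
  have h := ps_ode hb (coF_rec hb x) (y : ℂ)
  unfold ff ff1 ff2
  linear_combination Complex.exp (-(y : ℂ) / 2) * h

lemma ff_zero : ff b x 0 = 1 := by
  unfold ff
  simp [ps_zero, coF]

end ffun

lemma unif {b c Y ε : ℝ} (hb : 0 < b) (hY : 0 < Y) (hε : 0 < ε) :
    ∃ μ0 : ℝ, 0 < μ0 ∧ ∀ μ, μ0 ≤ μ → ∀ y ∈ Set.Icc 0 Y,
      ‖ff b (c + Complex.I * μ) y / gg b μ y - 1‖ ≤ ε := by
  obtain ⟨A, hA, hA2⟩ := ratio_bdd hb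
  set C : ℝ := |c - b / 2| + Y / 4 with hC
  have hC0 : 0 < C := by positivity
  set m := min ε 1 with hm
  have hm0 : 0 < m := by positivity
  set η := m / (4 * C * Y) with hη
  have hη0 : 0 < η := by positivity
  set δ := min (Y / 2) (m / (4 * C * (A + 1))) with hδ
  have hδ0 : 0 < δ := by positivity
  obtain ⟨r0, hr0, hr⟩ := ratio_small hb hη0
  have key : 2 * (C * (A * δ + η * Y)) ≤ m := by
    have h1 : C * (η * Y) = m / 4 := by rw [hη]; field_simp
    have h2 : C * (A * δ) ≤ m / 4 := by
      have h3 : A * δ ≤ (A + 1) * (m / (4 * C * (A + 1))) := by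
        apply mul_le_mul (by linarith) (min_le_right _ _) hδ0.le (by linarith)
      calc C * (A * δ) ≤ C * ((A + 1) * (m / (4 * C * (A + 1)))) := by gcongr
        _ = m / 4 := by field_simp
    linarith
  refine ⟨r0 / δ + 1, by positivity, fun μ hμ y hy => ?_⟩
  have hμ0 : 0 < μ := lt_of_lt_of_le (by positivity) hμ
  have hcmp := compare (q := fun y => ((c - b / 2 + y / 4 : ℝ) : ℂ)) (C := C) (A := A) (η := η)
    (δ := δ) (Y := Y) hb hμ0
    (gg_deriv hb) (gg1_deriv hb) (fun y _ => gg_ode hb y) gg_zero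
    (ff_deriv (x := c + Complex.I * μ) hb) (ff1_deriv hb) (fun y _ => ?_) ff_zero hC0.le hA hη0.le
    ?_ hδ0 ?_ ?_ ?_ ?_ hy
  · exact hcmp.trans (key.trans (min_le_left _ _))
  · rw [ff_ode hb]
    push_cast
    ring
  · intro y hy
    rw [Complex.norm_real, Real.norm_eq_abs]
    refine (abs_add_le _ _).trans ?_
    rw [abs_of_nonneg (show 0 ≤ y / 4 by linarith [hy.1])]
    have := hy.2
    rw [hC]
    gcongr
  · exact lt_of_le_of_lt (min_le_left _ _) (by linarith)
  · intro t ht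
    unfold gg gg1
    have := hA2 (μ * t) (mul_nonneg hμ0.le ht.1)
    rw [norm_mul, norm_mul, Complex.norm_I, one_mul, Complex.norm_real,
      Real.norm_of_nonneg hμ0.le, mul_assoc]
    gcongr
  · intro t ht
    unfold gg gg1
    have h1 : r0 ≤ μ * t := by
      have h2 : r0 / δ ≤ μ := by linarith
      rw [div_le_iff₀ hδ0] at h2
      exact h2.trans (by gcongr; exact ht.1)
    have := hr (μ * t) h1
    rw [norm_mul, norm_mul, Complex.norm_I, one_mul, Complex.norm_real,
      Real.norm_of_nonneg hμ0.le, mul_assoc]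
    gcongr
  · have := min_le_right ε 1
    linarith


lemma cpow_real_mul {r : ℝ} (hr : 0 < r) {z : ℂ} (hz : z ≠ 0) (e : ℝ) :
    ((r : ℂ) * z) ^ (e : ℂ) = ((r ^ e : ℝ) : ℂ) * z ^ (e : ℂ) := by
  have hr0 : (r : ℂ) ≠ 0 := by exact_mod_cast hr.ne'
  rw [Complex.ofReal_cpow hr.le, Complex.cpow_def_of_ne_zero (mul_ne_zero hr0 hz),
    Complex.log_ofReal_mul hr hz, Complex.ofReal_log hr.le, add_mul, Complex.exp_add,
    ← Complex.cpow_def_of_ne_zero hr0, ← Complex.cpow_def_of_ne_zero hz]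

lemma one_add_I_cpow (e : ℝ) : (1 + Complex.I) ^ (2 * (e : ℂ))
    = ((2 ^ e : ℝ) : ℂ) * Complex.I ^ (e : ℂ) := by
  have h1 : 0 < (1 + Complex.I).re := by simp
  have h2 := Complex.neg_pi_div_two_lt_arg_iff.2 (Or.inl h1)
  have h3 := Complex.arg_le_pi_div_two_iff.2 (Or.inl h1.le)
  have h := Complex.cpow_nat_mul' (x := 1 + Complex.I) (n := 2) (by push_cast; linarith)
    (by push_cast; linarith) e
  rw [← cpow_real_mul two_pos Complex.I_ne_zero]
  have e1 : (1 + Complex.I) ^ 2 = ((2 : ℝ) : ℂ) * Complex.I := by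
    push_cast
    linear_combination Complex.I_sq
  rw [e1] at h
  exact_mod_cast h

lemma third_lim (c e : ℝ) : Tendsto (fun μ : ℝ => (((μ / 2) ^ e : ℝ) : ℂ) *
    (1 + Complex.I) ^ (2 * (e : ℂ)) / (c + Complex.I * μ) ^ (e : ℂ)) atTop (𝓝 1) := by
  have h0 : Tendsto (fun T : ℝ => ((T : ℝ) : ℂ)⁻¹) atTop (𝓝 0) := by
    have := (Complex.continuous_ofReal.tendsto 0).comp tendsto_inv_atTop_zero
    simpa [Function.comp_def] using this
  have h1 : Tendsto (fun μ : ℝ => (c : ℂ) * (μ : ℂ)⁻¹ + Complex.I) atTop (𝓝 Complex.I) := by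
    simpa using (h0.const_mul (c : ℂ)).add_const Complex.I
  have hs : Complex.I ∈ Complex.slitPlane := by simp [Complex.mem_slitPlane_iff]
  have hI : Complex.I ^ (e : ℂ) ≠ 0 := by
    rw [Ne, Complex.cpow_eq_zero_iff]
    have := Complex.I_ne_zero
    tauto
  have h2 : Tendsto (fun μ : ℝ => ((c : ℂ) * (μ : ℂ)⁻¹ + Complex.I) ^ (e : ℂ)) atTop
      (𝓝 (Complex.I ^ (e : ℂ))) := h1.cpow tendsto_const_nhds hs
  have h3 := h2.inv₀ hI |>.const_mul (Complex.I ^ (e : ℂ))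
  rw [mul_inv_cancel₀ hI] at h3
  refine h3.congr' ?_
  filter_upwards [eventually_gt_atTop 0] with μ hμ
  have hμ0 : (μ : ℂ) ≠ 0 := by exact_mod_cast hμ.ne'
  have e1 : c + Complex.I * μ = (μ : ℂ) * (c * (μ : ℂ)⁻¹ + Complex.I) := by
    field_simp
  have hz : (c : ℂ) * (μ : ℂ)⁻¹ + Complex.I ≠ 0 := by
    intro h
    have := congrArg Complex.im h
    rw [← Complex.ofReal_inv, ← Complex.ofReal_mul, Complex.add_im, Complex.ofReal_im] at this
    simp at this
  have hp : ((μ ^ e : ℝ) : ℂ) ≠ 0 := by exact_mod_cast (Real.rpow_pos_of_pos hμ _).ne'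
  have h2p : ((2 ^ e : ℝ) : ℂ) ≠ 0 := by exact_mod_cast (Real.rpow_pos_of_pos two_pos _).ne'
  rw [e1, cpow_real_mul hμ hz, one_add_I_cpow, Real.div_rpow hμ.le two_pos.le, Complex.ofReal_div]
  generalize ((2 ^ e : ℝ) : ℂ) = p2 at *
  generalize ((μ ^ e : ℝ) : ℂ) = pm at *
  rw [← div_eq_mul_inv]
  have : p2 * (p2)⁻¹ = 1 := mul_inv_cancel₀ h2p
  have h4 : pm / p2 * (p2 * Complex.I ^ (e : ℂ)) = pm * Complex.I ^ (e : ℂ) := by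
    rw [← mul_assoc, div_mul_cancel₀ _ h2p]
  rw [h4, mul_div_mul_left _ _ hp]

/-- Algebraic factorisation of the ratio. -/
lemma ratio_eq {b c μ y T : ℝ} (hb : 0 < b) (hμ : 0 < μ) (hy : 0 < y) (hT : 0 < T)
    (hTy : T ^ 2 / 2 = μ * y) :
    hyp1F1 (c + Complex.I * μ) b y /
      ((Complex.exp ((y / 2 : ℝ) : ℂ) / (2 * (Real.sqrt Real.pi : ℂ))) *
        ((y : ℂ) ^ ((1 / 4 - b / 2 : ℝ) : ℂ)) * (Real.Gamma b : ℂ) *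
        ((c + Complex.I * μ) ^ ((1 / 4 - b / 2 : ℝ) : ℂ)) * Complex.exp ((1 + Complex.I) * T))
    = ff b (c + Complex.I * μ) y / gg b μ y * (Nrm b T / Lim b) *
      ((((μ / 2) ^ (1 / 4 - b / 2) : ℝ) : ℂ) * (1 + Complex.I) ^ (2 * ((1 / 4 - b / 2 : ℝ) : ℂ))
        / (c + Complex.I * μ) ^ ((1 / 4 - b / 2 : ℝ) : ℂ)) := by
  have hF : hyp1F1 (c + Complex.I * μ) b y
      = Complex.exp ((y / 2 : ℝ) : ℂ) * ff b (c + Complex.I * μ) y := by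
    unfold ff
    rw [← mul_assoc, ← Complex.exp_add]
    have : ((y / 2 : ℝ) : ℂ) + -(y : ℂ) / 2 = 0 := by push_cast; ring
    rw [this, Complex.exp_zero, one_mul]
    rfl
  set e : ℝ := 1 / 4 - b / 2 with he
  have hg : gg b μ y ≠ 0 := by
    unfold gg
    exact G_ne hb (by positivity)
  have hN : Nrm b T = gg b μ y * (Complex.exp ((1 + Complex.I) * T))⁻¹ *
      ((T ^ (b - 1 / 2) : ℝ) : ℂ) := by
    unfold Nrm gg
    rw [hTy, ← Complex.exp_neg]
    congr 3
    ring
  have hy0 : (y : ℂ) ^ (e : ℂ) = ((y ^ e : ℝ) : ℂ) := (Complex.ofReal_cpow hy.le e).symm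
  have hL : Lim b = Real.Gamma b / (2 * Real.sqrt Real.pi) * (2 ^ (b - 1 / 2) : ℝ) *
      (1 + Complex.I) ^ (2 * (e : ℂ)) := by
    unfold Lim
    congr 2
    rw [he]
    push_cast
    ring
  have hI : (1 + Complex.I) ^ (2 * (e : ℂ)) ≠ 0 := by
    rw [Ne, Complex.cpow_eq_zero_iff]
    have : (1 + Complex.I) ≠ 0 := by
      intro h; simpa using congrArg Complex.re h
    tauto
  have hpow : (T ^ (b - 1 / 2) : ℝ) * (μ / 2) ^ e * y ^ e = 2 ^ (b - 1 / 2) := by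
    rw [mul_assoc, ← Real.mul_rpow (by positivity) hy.le,
      show μ / 2 * y = (T / 2) ^ (2 : ℝ) by rw [Real.rpow_two]; linarith [hTy],
      ← Real.rpow_mul (by positivity), show 2 * e = -(b - 1 / 2) by rw [he]; ring,
      Real.rpow_neg (by positivity), Real.div_rpow hT.le two_pos.le]
    have := Real.rpow_pos_of_pos hT (b - 1 / 2)
    field_simp
  have hpow' : ((2 ^ (b - 1 / 2) : ℝ) : ℂ) = ((T ^ (b - 1 / 2) : ℝ) : ℂ) *
      (((μ / 2) ^ e : ℝ) : ℂ) * ((y ^ e : ℝ) : ℂ) := by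
    rw [← hpow]; push_cast; rfl
  have n1 : ((T ^ (b - 1 / 2) : ℝ) : ℂ) ≠ 0 := by
    exact_mod_cast (Real.rpow_pos_of_pos hT _).ne'
  have n2 : (((μ / 2) ^ e : ℝ) : ℂ) ≠ 0 := by
    exact_mod_cast (Real.rpow_pos_of_pos (by positivity) _).ne'
  have n3 : ((y ^ e : ℝ) : ℂ) ≠ 0 := by
    exact_mod_cast (Real.rpow_pos_of_pos hy _).ne'
  have n4 : (Real.Gamma b : ℂ) ≠ 0 := by exact_mod_cast (Real.Gamma_pos_of_pos hb).ne'
  have n5 : (Real.sqrt Real.pi : ℂ) ≠ 0 := by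
    exact_mod_cast (Real.sqrt_pos.2 Real.pi_pos).ne'
  have n6 := Complex.exp_ne_zero ((1 + Complex.I) * T)
  have n7 := Complex.exp_ne_zero ((y / 2 : ℝ) : ℂ)
  have n8 : (c + Complex.I * μ) ^ (e : ℂ) ≠ 0 := by
    rw [Ne, Complex.cpow_eq_zero_iff]
    have : (c : ℂ) + Complex.I * μ ≠ 0 := by
      intro h
      have := congrArg Complex.im h
      simp at this
      exact hμ.ne' this
    tauto
  rw [hF, hN, hL, hy0, hpow']
  generalize ((T ^ (b - 1 / 2) : ℝ) : ℂ) = k1 at *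
  generalize (((μ / 2) ^ e : ℝ) : ℂ) = k2 at *
  generalize ((y ^ e : ℝ) : ℂ) = k3 at *
  generalize (c + Complex.I * μ : ℂ) ^ (e : ℂ) = k4 at *
  generalize Complex.exp ((1 + Complex.I) * T) = k5 at *
  generalize Complex.exp ((y / 2 : ℝ) : ℂ) = k6 at *
  generalize (1 + Complex.I) ^ (2 * (e : ℂ)) = k7 at *
  generalize (Real.Gamma b : ℂ) = k8 at *
  generalize gg b μ y = k9 at *
  generalize ff b (c + Complex.I * μ) y = k10 at *
  field_simp

/-- Equation (4.4): uniform asymptotics of the Kummer function along the upper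
imaginary direction, uniformly for `v` in a compact subset of `(0, ∞)`. -/
theorem kummer_asymptotics_upper
    (a σ κ : ℝ) (ha : 0 < a) (hσ : 0 < σ) (hκ : 0 < κ)
    (j : ℕ) (hj : j ≤ 1)
    (K : Set ℝ) (hK : IsCompact K) (hKpos : K ⊆ Set.Ioi 0) :
    TendstoUniformlyOn
      (fun (u : ℝ) (v : ℝ) =>
        hyp1F1 ((1 + u * Complex.I) / κ + j) (2 * a / σ ^ 2 + j)
            ((2 * κ * v / σ ^ 2 : ℝ) : ℂ) /
          ((Complex.exp ((κ * v / σ ^ 2 : ℝ) : ℂ) / (2 * (Real.sqrt Real.pi : ℂ))) *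
            (((2 * κ * v / σ ^ 2 : ℝ) : ℂ)
              ^ (((1 : ℂ) / 4 - (j : ℂ) / 2 - (a : ℂ) / (σ : ℂ) ^ 2) : ℂ)) *
            Complex.Gamma (2 * a / σ ^ 2 + j) *
            (((1 + u * Complex.I) / κ + j)
              ^ (((1 : ℂ) / 4 - (j : ℂ) / 2 - (a : ℂ) / (σ : ℂ) ^ 2) : ℂ)) *
            Complex.exp (2 * (1 + Complex.I) * (Real.sqrt (v * u / σ ^ 2) : ℂ))))
      (fun _ => 1) atTop K := by
  rcases K.eq_empty_or_nonempty with rfl | hne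
  · exact tendstoUniformlyOn_empty
  obtain ⟨v0, hv0, hmin⟩ := hK.exists_isMinOn hne continuousOn_id
  obtain ⟨V, hV, hmax⟩ := hK.exists_isMaxOn hne continuousOn_id
  have hv0p : 0 < v0 := hKpos hv0
  have hVp : 0 < V := hKpos hV
  set b : ℝ := 2 * a / σ ^ 2 + j with hbdef
  have hb : 0 < b := by positivity
  set c : ℝ := 1 / κ + j with hc
  set e : ℝ := 1 / 4 - b / 2 with he
  have L1 : Tendsto (fun p : ℝ × ℝ => ff b (c + Complex.I * ((p.1 / κ : ℝ) : ℂ)) (2 * κ * p.2 / σ ^ 2)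
      / gg b (p.1 / κ) (2 * κ * p.2 / σ ^ 2)) (atTop ×ˢ 𝓟 K) (𝓝 1) := by
    rw [Metric.tendsto_nhds]
    intro ε hε
    obtain ⟨μ0, hμ0, h⟩ := unif (c := c) (Y := 2 * κ * V / σ ^ 2) (ε := ε / 2) hb (by positivity)
      (by positivity)
    rw [eventually_prod_principal_iff]
    filter_upwards [eventually_ge_atTop (μ0 * κ)] with u hu v hv
    have h1 := h (u / κ) (by rwa [le_div_iff₀ hκ]) (2 * κ * v / σ ^ 2) ⟨?_, ?_⟩
    · rw [dist_eq_norm]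
      exact lt_of_le_of_lt h1 (by linarith)
    · have : 0 < v := hKpos hv
      positivity
    · have : v ≤ V := hmax hv
      gcongr
  have hT : Tendsto (fun p : ℝ × ℝ => 2 * Real.sqrt (p.2 * p.1 / σ ^ 2)) (atTop ×ˢ 𝓟 K) atTop := by
    have h1 : Tendsto (fun u : ℝ => 2 * Real.sqrt (v0 * u / σ ^ 2)) atTop atTop := by
      refine Tendsto.const_mul_atTop two_pos (Real.tendsto_sqrt_atTop.comp ?_)
      exact (tendsto_id.const_mul_atTop hv0p).atTop_div_const (by positivity)
    refine tendsto_atTop_mono' _ ?_ (h1.comp tendsto_fst)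
    rw [EventuallyLE, eventually_prod_principal_iff]
    filter_upwards [eventually_ge_atTop 0] with u hu v hv
    have : v0 ≤ v := hmin hv
    simp only [Function.comp]
    gcongr
  have L2 := ((nrm_lim hb).comp hT).div_const (Lim b)
  rw [div_self (Lim_ne hb)] at L2
  have hμ : Tendsto (fun p : ℝ × ℝ => p.1 / κ) (atTop ×ˢ 𝓟 K) atTop :=
    (tendsto_id.atTop_div_const hκ).comp tendsto_fst
  have L3 := (third_lim c e).comp hμ
  have L := (L1.mul L2).mul L3
  rw [one_mul, one_mul] at L
  rw [← tendsto_prod_principal_iff]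
  refine L.congr' ?_
  rw [EventuallyEq, eventually_prod_principal_iff]
  filter_upwards [eventually_gt_atTop 0] with u hu v hv
  have hv' : 0 < v := hKpos hv
  have hr := ratio_eq (b := b) (c := c) (μ := u / κ) (y := 2 * κ * v / σ ^ 2)
    (T := 2 * Real.sqrt (v * u / σ ^ 2)) hb (by positivity) (by positivity) (by positivity) ?_
  · simp only [Function.comp, Function.HasUncurry.uncurry, id]
    rw [← hr]
    have x1 : (1 + (u : ℂ) * Complex.I) / κ + j = c + Complex.I * ((u / κ : ℝ) : ℂ) := by
      rw [hc]; push_cast; ring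
    have x2 : 2 * (a : ℂ) / σ ^ 2 + j = (b : ℂ) := by
      rw [hbdef]; push_cast; ring
    have x3 : (1 : ℂ) / 4 - (j : ℂ) / 2 - (a : ℂ) / (σ : ℂ) ^ 2 = ((1 / 4 - b / 2 : ℝ) : ℂ) := by
      rw [hbdef]; push_cast; ring
    have x4 : κ * v / σ ^ 2 = 2 * κ * v / σ ^ 2 / 2 := by ring
    have x5 : 2 * (1 + Complex.I) * (Real.sqrt (v * u / σ ^ 2) : ℂ)
        = (1 + Complex.I) * ((2 * Real.sqrt (v * u / σ ^ 2) : ℝ) : ℂ) := by push_cast; ring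
    rw [x1, x2, x3, x4, x5, Complex.Gamma_ofReal]
  · rw [mul_pow, Real.sq_sqrt (by positivity)]
    field_simp

end
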